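/- Let x_1, ..., x_d be a C-system of parameters of M. Then there is a surjective k-linear map from Soc(H^{d-1}_m(M/x_1M)) onto Soc(H^d_m(M)); in particular dim_k Soc(H^d_m(M)) ≤ dim_k Soc(H^{d-1}_m(M/x_1M)). -/

import Mathlib

open IsLocalRing

universe u

namespace Paper

variable (R : Type u) [CommRing R]

/-- `dim_{R/I} Soc_I(N)` where `Soc_I(N) = (0 :_N I)`. -/
noncomputable def socDim (I : Ideal R) (N : Type u) [AddCommGroup N] [Module R N] : ℕ :=
  Module.finrank (R ⧸ I) (Submodule.torsionBySet R N (I : Set R))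

/-- Krull dimension of a module (`⊥` for the zero module). -/
noncomputable def mdim (M : Type u) [AddCommGroup M] [Module R M] : WithBot (WithTop ℕ) :=
  ringKrullDim (R ⧸ Module.annihilator R M)

/-- The index of reducibility of an ideal `q` on `M`: `dim_k Soc (M/qM)`. -/
noncomputable def ir [IsLocalRing R] (M : Type u) [AddCommGroup M] [Module R M]
    (q : Ideal R) : ℕ :=
  socDim R (maximalIdeal R) (M ⧸ (q • ⊤ : Submodule R M))

/-- `dim_k Soc (H^i_m(M))`. -/
noncomputable def socH [IsLocalRing R] (M : Type u) [AddCommGroup M] [Module R M] (i : ℕ) : ℕ :=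
  socDim R (maximalIdeal R) ((localCohomology (maximalIdeal R) i).obj (ModuleCat.of R M))

/-- A system of parameters of `M` (of length `d`): `d` elements of the maximal ideal such
that the quotient has finite length. -/
def IsSOP [IsLocalRing R] (M : Type u) [AddCommGroup M] [Module R M] (d : ℕ)
    (x : Fin d → R) : Prop :=
  (∀ i, x i ∈ maximalIdeal R) ∧
    IsFiniteLength R (M ⧸ (Ideal.span (Set.range x) • ⊤ : Submodule R M))

/-- A parameter element: an element occurring in some system of parameters of `M`. -/
def IsParamElement [IsLocalRing R] (M : Type u) [AddCommGroup M] [Module R M] (d : ℕ)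
    (a : R) : Prop :=
  ∃ x : Fin d → R, IsSOP R M d x ∧ ∃ i, x i = a

/-- The ideal `b(M) = ⋂ Ann (0 :_{M/(x_1,...,x_{i-1})M} x_i)`, the intersection running over
all systems of parameters `x_1, ..., x_d` of `M`. -/
noncomputable def bIdeal [IsLocalRing R] (M : Type u) [AddCommGroup M] [Module R M]
    (d : ℕ) : Ideal R :=
  ⨅ (x : Fin d → R) (_ : IsSOP R M d x) (i : Fin d),
    Module.annihilator R
      (Submodule.torsionBy R (M ⧸ (Ideal.span (x '' {j | j < i}) • ⊤ : Submodule R M)) (x i))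

/-- A C-system of parameters: `x_i ∈ b(M/(x_{i+1},...,x_d)M)^3` for all `i`. -/
def IsCSOP [IsLocalRing R] (M : Type u) [AddCommGroup M] [Module R M] (d : ℕ)
    (x : Fin d → R) : Prop :=
  IsSOP R M d x ∧ ∀ i : Fin d,
    x i ∈ (bIdeal R (M ⧸ (Ideal.span (x '' {j | i < j}) • ⊤ : Submodule R M)) ((i : ℕ) + 1)) ^ 3

/-- The depth of `M`: the supremum of the lengths of `M`-regular sequences contained in the
maximal ideal. -/
noncomputable def depth [IsLocalRing R] (M : Type u) [AddCommGroup M] [Module R M] :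
    WithTop ℕ :=
  sSup {n : WithTop ℕ | ∃ rs : List R, (rs.length : WithTop ℕ) = n ∧
    (∀ r ∈ rs, r ∈ maximalIdeal R) ∧ RingTheory.Sequence.IsRegular M rs}

/-- `M` is a Cohen-Macaulay module: `depth M = dim M`. -/
def IsCM [IsLocalRing R] (M : Type u) [AddCommGroup M] [Module R M] : Prop :=
  (depth R M : WithBot (WithTop ℕ)) = mdim R M

/-- A Cohen-Macaulay local ring. -/
def IsCMLocalRing (S : Type u) [CommRing S] [IsLocalRing S] : Prop :=
  IsNoetherianRing S ∧ IsCM S S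

/-- `R` is a homomorphic image of a Cohen-Macaulay (Noetherian) local ring. -/
def IsQuotientOfCMLocalRing : Prop :=
  ∃ (S : Type u) (_ : CommRing S) (_ : IsLocalRing S),
    IsCMLocalRing S ∧ ∃ f : S →+* R, Function.Surjective f

/-- The largest submodule of (the submodule) `N` whose dimension is strictly smaller than
that of `N`. -/
noncomputable def uComp (M : Type u) [AddCommGroup M] [Module R M] (N : Submodule R M) :
    Submodule R M :=
  sSup {P : Submodule R M | P ≤ N ∧ mdim R P < mdim R N}

/-- The unmixed component `U_M(0)` of `M`: the largest submodule of dimension `< dim M`. -/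
noncomputable def unmixedComp (M : Type u) [AddCommGroup M] [Module R M] : Submodule R M :=
  uComp R M ⊤

/-- The 0-th local cohomology `H^0_m(M)` realized as the submodule of elements annihilated by
some power of the maximal ideal. -/
def H0sub [IsLocalRing R] (M : Type u) [AddCommGroup M] [Module R M] : Submodule R M :=
  ⨆ n : ℕ, Submodule.torsionBySet R M (((maximalIdeal R) ^ n : Ideal R) : Set R)

/-- The quotient `P/N` of two submodules of `M`. -/
abbrev subQuot (M : Type u) [AddCommGroup M] [Module R M] (P N : Submodule R M) :=
  P ⧸ (Submodule.comap P.subtype N)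

/-- `D_0 ⊆ D_1 ⊆ ⋯ ⊆ D_t = M` is the dimension filtration of `M`:
`D_t = M`, each `D_{i-1}` is the largest submodule of `D_i` of strictly smaller dimension,
and `D_0 = H^0_m(M)`. -/
def IsDimFiltration [IsLocalRing R] (M : Type u) [AddCommGroup M] [Module R M]
    (t : ℕ) (D : Fin (t + 1) → Submodule R M) : Prop :=
  D (Fin.last t) = ⊤ ∧ (∀ i : Fin t, D i.castSucc = uComp R M (D i.succ)) ∧
    D 0 = H0sub R M

/-- `M` is sequentially Cohen-Macaulay: all quotients `D_i/D_{i-1}` of the dimension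
filtration are Cohen-Macaulay. -/
def IsSeqCM [IsLocalRing R] (M : Type u) [AddCommGroup M] [Module R M] : Prop :=
  ∃ (t : ℕ) (D : Fin (t + 1) → Submodule R M), IsDimFiltration R M t D ∧
    ∀ i : Fin t, IsCM R (subQuot R M (D i.succ) (D i.castSucc))

/-- `M` (of dimension `d`) is generalized Cohen-Macaulay: `H^i_m(M)` has finite length
for all `i < d`. -/
def IsGenCM [IsLocalRing R] (M : Type u) [AddCommGroup M] [Module R M] (d : ℕ) : Prop :=
  ∀ i < d, IsFiniteLength R ((localCohomology (maximalIdeal R) i).obj (ModuleCat.of R M))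

/-- `α_n(M)`: the minimum of the indices of reducibility of parameter ideals of `M`
contained in `m^n`. -/
noncomputable def alphaN [IsLocalRing R] (M : Type u) [AddCommGroup M] [Module R M]
    (d n : ℕ) : ℕ :=
  sInf {r : ℕ | ∃ x : Fin d → R, IsSOP R M d x ∧
    Ideal.span (Set.range x) ≤ (maximalIdeal R) ^ n ∧ r = ir R M (Ideal.span (Set.range x))}

/-- The limit value `α(M) = lim_n α_n(M)` (the supremum of the non-decreasing sequence). -/
noncomputable def alphaLim [IsLocalRing R] (M : Type u) [AddCommGroup M] [Module R M]
    (d : ℕ) : ℕ :=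
  ⨆ n : ℕ, alphaN R M d (n + 1)

/-- `M` is unmixed: `dim R/p = dim M` for all associated primes `p`. -/
def IsUnmixed (M : Type u) [AddCommGroup M] [Module R M] : Prop :=
  ∀ p ∈ associatedPrimes R M, ringKrullDim (R ⧸ p) = mdim R M

/-- Serre's condition `(S_2)` for a module. -/
def IsS2 (L : Type u) [AddCommGroup L] [Module R L] : Prop :=
  ∀ p : PrimeSpectrum R, p ∈ Module.support R L →
    min 2 (mdim (Localization.AtPrime p.asIdeal) (LocalizedModule p.asIdeal.primeCompl L)) ≤
      (depth (Localization.AtPrime p.asIdeal) (LocalizedModule p.asIdeal.primeCompl L) :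
        WithBot (WithTop ℕ))

/-- `ι : M →ₗ[R] S` exhibits `S` as an `S_2`-ification of `M`. -/
def IsS2ification [IsLocalRing R] (M S : Type u) [AddCommGroup M] [Module R M]
    [AddCommGroup S] [Module R S] (ι : M →ₗ[R] S) : Prop :=
  Function.Injective ι ∧ Module.Finite R S ∧ IsS2 R S ∧
    ∀ (p : Ideal R) [p.IsPrime], p ≠ maximalIdeal R →
      IsS2 (Localization.AtPrime p) (LocalizedModule p.primeCompl M) →
      Function.Surjective (IsLocalizedModule.map p.primeCompl
        (LocalizedModule.mkLinearMap p.primeCompl M)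
        (LocalizedModule.mkLinearMap p.primeCompl S) ι)

end Paper

namespace LCAux
open CategoryTheory Limits Opposite

section ExtPres
variable {R : Type u} [CommRing R] {X : ModuleCat.{u} R} (P : ProjectiveResolution X)
  (Y : ModuleCat.{u} R) (i : ℕ)

/-- The complex `op Hom(P, Y)`. -/
noncomputable abbrev opC : HomologicalComplex (ModuleCat.{u} R)ᵒᵖ (ComplexShape.down ℕ) :=
  (((linearYoneda R (ModuleCat.{u} R)).obj Y).rightOp.mapHomologicalComplex _).obj P.complex

noncomputable def isoD :
    (((linearYoneda R (ModuleCat.{u} R)).obj Y).rightOp.leftDerived i).obj X ≅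
      (opC P Y).homology i :=
  P.isoLeftDerivedObj ((linearYoneda R (ModuleCat.{u} R)).obj Y).rightOp i

/-- The augmentation. -/
noncomputable def aug : P.complex.X 0 ⟶ X := P.π.f 0

noncomputable def qMap : unop ((opC P Y).opcycles i) ⟶
    ((Ext R (ModuleCat.{u} R) i).obj (op X)).obj Y :=
  ((isoD P Y i).hom ≫ (opC P Y).homologyι i).unop

noncomputable def jMap : unop ((opC P Y).opcycles i) ⟶
    (ModuleCat.of R (P.complex.X i ⟶ Y)) :=
  ((opC P Y).pOpcycles i).unop

lemma qMap_surj : Function.Surjective (qMap P Y i) := by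
  rw [← ModuleCat.epi_iff_surjective]
  exact unop_epi_of_mono _

lemma jMap_inj : Function.Injective (jMap P Y i) := by
  rw [← ModuleCat.mono_iff_injective]
  unfold jMap
  exact unop_mono_of_epi _

lemma jMap_range (f : P.complex.X i ⟶ Y) :
    (∃ z, jMap P Y i z = f) ↔ P.complex.d (i+1) i ≫ f = 0 := by
  have h1 := ShortComplex.exact_of_g_is_cokernel
    (ShortComplex.mk _ _ ((opC P Y).d_pOpcycles (i+1) i)) 
    ((opC P Y).opcyclesIsCokernel (i+1) i (by simp))
  have h2 := h1.unop
  rw [ShortComplex.moduleCat_exact_iff] at h2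
  constructor
  · rintro ⟨z, rfl⟩
    have := (opC P Y).d_pOpcycles (i+1) i
    have := congrArg Quiver.Hom.unop this
    have := ConcreteCategory.congr_hom this z
    exact this
  · intro hf
    exact h2 f hf

lemma qMap_ker (z) :
    qMap P Y i z = 0 ↔ ∃ g : P.complex.X (i-1) ⟶ Y, P.complex.d i (i-1) ≫ g = jMap P Y i z := by
  have h1 := ShortComplex.exact_of_f_is_kernel
    (ShortComplex.mk _ _ ((opC P Y).homologyι_comp_fromOpcycles i (i-1)))
    ((opC P Y).homologyIsKernel i (i-1) (by cases i <;> simp))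
  have h2 := h1.unop
  rw [ShortComplex.moduleCat_exact_iff] at h2
  have hd : ∀ g : P.complex.X (i-1) ⟶ Y, P.complex.d i (i-1) ≫ g =
      jMap P Y i (((opC P Y).fromOpcycles i (i-1)).unop g) := by
    intro g
    have := congrArg Quiver.Hom.unop ((opC P Y).p_fromOpcycles i (i-1))
    exact (ConcreteCategory.congr_hom this g).symm
  have hq : qMap P Y i z = 0 ↔ ((opC P Y).homologyι i).unop z = 0 := by
    have hm : Function.Injective ((isoD P Y i).hom).unop := by
      rw [← ModuleCat.mono_iff_injective]
      exact unop_mono_of_epi _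
    have he : qMap P Y i z = ((isoD P Y i).hom).unop
        (((opC P Y).homologyι i).unop z) := rfl
    rw [he]
    exact ⟨fun h => hm (h.trans (map_zero _).symm), fun h => by rw [h, map_zero]; rfl⟩
  rw [hq]
  constructor
  · intro h
    obtain ⟨g, hg⟩ := h2 z h
    exact ⟨g, (hd g).trans (congrArg _ hg)⟩
  · rintro ⟨g, hg⟩
    rw [hd] at hg
    have := jMap_inj P Y i hg
    rw [← this]
    have := congrArg Quiver.Hom.unop ((opC P Y).homologyι_comp_fromOpcycles i (i-1))
    exact (ConcreteCategory.congr_hom this g)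

variable {X' : ModuleCat.{u} R} (P' : ProjectiveResolution X')

lemma ext_nat (a : X' ⟶ X) (φ : P'.complex ⟶ P.complex)
    (comm : φ.f 0 ≫ aug P = aug P' ≫ a) (z) :
    ∃ z', jMap P' Y i z' = φ.f i ≫ jMap P Y i z ∧
      qMap P' Y i z' = (((Ext R (ModuleCat.{u} R) i).map a.op).app Y) (qMap P Y i z) := by
  let F := ((linearYoneda R (ModuleCat.{u} R)).obj Y).rightOp
  let Φ : opC P' Y ⟶ opC P Y := (F.mapHomologicalComplex _).map φ
  refine ⟨(HomologicalComplex.opcyclesMap Φ i).unop z, ?_, ?_⟩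
  · have := congrArg Quiver.Hom.unop (HomologicalComplex.p_opcyclesMap Φ i)
    exact (ConcreteCategory.congr_hom this z)
  · have h1 : (F.leftDerived i).map a ≫ (isoD P Y i).hom = (isoD P' Y i).hom ≫
        HomologicalComplex.homologyMap Φ i := ProjectiveResolution.isoLeftDerivedObj_hom_naturality a P' P φ comm F i
    have h2 : (F.leftDerived i).map a ≫ ((isoD P Y i).hom ≫ (opC P Y).homologyι i) =
        ((isoD P' Y i).hom ≫ (opC P' Y).homologyι i) ≫
          HomologicalComplex.opcyclesMap Φ i := by
      rw [← Category.assoc, h1, Category.assoc, Category.assoc]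
      congr 1
      exact HomologicalComplex.homologyι_naturality Φ i
    have := congrArg Quiver.Hom.unop h2
    exact (ConcreteCategory.congr_hom this z).symm

end ExtPres

section LC
variable {R : Type u} [CommRing R] (J : Ideal R)

noncomputable abbrev Pr (n : ℕ) : ProjectiveResolution (ModuleCat.of R (R ⧸ J ^ n)) :=
  projectiveResolution _

noncomputable def trans {n k : ℕ} (h : n ≤ k) :
    ModuleCat.of R (R ⧸ J ^ k) ⟶ ModuleCat.of R (R ⧸ J ^ n) :=
  ModuleCat.ofHom <| Submodule.mapQ _ _ LinearMap.id (Ideal.pow_le_pow_right h)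

/-- Lifts of the projections `R/J^k → R/J^n` to the resolutions. -/
def IsLift {n k : ℕ} (φ : (Pr J k).complex ⟶ (Pr J n).complex) : Prop :=
  ∃ h : n ≤ k, φ.f 0 ≫ aug (Pr J n) = aug (Pr J k) ≫ trans J h

lemma exists_lift {n k : ℕ} (h : n ≤ k) : ∃ φ : (Pr J k).complex ⟶ (Pr J n).complex, IsLift J φ :=
  ⟨ProjectiveResolution.lift (trans J h) _ _, h, ProjectiveResolution.lift_commutes_zero _ _ _⟩

lemma IsLift.comp {n k l : ℕ} {φ : (Pr J k).complex ⟶ (Pr J n).complex}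
    {ψ : (Pr J l).complex ⟶ (Pr J k).complex} (hφ : IsLift J φ) (hψ : IsLift J ψ) :
    IsLift J (ψ ≫ φ) := by
  obtain ⟨h1, e1⟩ := hφ
  obtain ⟨h2, e2⟩ := hψ
  refine ⟨h1.trans h2, ?_⟩
  rw [HomologicalComplex.comp_f, Category.assoc, e1, reassoc_of% e2]
  congr 1
  ext1
  apply Submodule.linearMap_qext
  rfl

lemma isLift_id (n : ℕ) : IsLift J (𝟙 (Pr J n).complex) := by
  refine ⟨le_rfl, ?_⟩
  have : trans J (le_refl n) = 𝟙 _ := by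
    ext1
    apply Submodule.linearMap_qext
    rfl
  rw [this, HomologicalComplex.id_f, Category.id_comp, Category.comp_id]

variable (M : Type u) [AddCommGroup M] [Module R M] (i : ℕ)

abbrev LC : Type u := (localCohomology J i).obj (ModuleCat.of R M)

noncomputable def lcι (n : ℕ) : ((Ext R (ModuleCat.{u} R) i).obj (op (ModuleCat.of R (R ⧸ J ^ n)))).obj
      (ModuleCat.of R M) ⟶ (localCohomology J i).obj (ModuleCat.of R M) :=
  (colimit.ι (localCohomology.diagram (localCohomology.idealPowersDiagram J) i) (op (op n))).app _

noncomputable instance : PreservesColimitsOfShape ℕᵒᵖᵒᵖ (forget (ModuleCat.{u} R)) := by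
  have : PreservesFilteredColimitsOfSize.{0, 0} (forget (ModuleCat.{u} R)) :=
    preservesFilteredColimitsOfSize_shrink.{0, u, 0, u} _
  have : IsFiltered ℕᵒᵖᵒᵖ := IsFiltered.of_equivalence (opOpEquivalence ℕ).symm
  infer_instance

instance : IsFiltered ℕᵒᵖᵒᵖ := IsFiltered.of_equivalence (opOpEquivalence ℕ).symm

lemma lcι_surj (h : LC J M i) : ∃ n y, lcι J M i n y = h := by
  have hc := isColimitOfPreserves ((evaluation _ _).obj (ModuleCat.of R M))
    (colimit.isColimit (localCohomology.diagram (localCohomology.idealPowersDiagram J) i))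
  obtain ⟨j, y, hy⟩ := Concrete.isColimit_exists_rep _ hc h
  exact ⟨j.unop.unop, y, hy⟩

lemma lcι_trans {n k : ℕ} (h : n ≤ k) (y) :
    lcι J M i k (((Ext R (ModuleCat.{u} R) i).map (trans J h).op).app (ModuleCat.of R M) y) =
      lcι J M i n y := by
  let a : (op (op n) : ℕᵒᵖᵒᵖ) ⟶ op (op k) := (homOfLE h).op.op
  have := colimit.w (localCohomology.diagram (localCohomology.idealPowersDiagram J) i) a
  have := NatTrans.congr_app this (ModuleCat.of R M)
  exact ConcreteCategory.congr_hom this y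

lemma lcι_zero {n : ℕ} (y) (hy : lcι J M i n y = 0) : ∃ k, ∃ h : n ≤ k,
    ((Ext R (ModuleCat.{u} R) i).map (trans J h).op).app (ModuleCat.of R M) y = 0 := by
  have hc := isColimitOfPreserves ((evaluation _ _).obj (ModuleCat.of R M))
    (colimit.isColimit (localCohomology.diagram (localCohomology.idealPowersDiagram J) i))
  obtain ⟨k, f, g, hfg⟩ := Concrete.isColimit_exists_of_rep_eq _ (i := op (op n))
    (j := op (op n)) hc y 0 (hy.trans (map_zero _).symm)
  refine ⟨k.unop.unop, leOfHom f.unop.unop, ?_⟩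
  rw [map_zero] at hfg
  exact hfg


/-- The modules of the chosen projective resolution of `R/J^n`. -/
abbrev PX (n i : ℕ) : Type u := (Pr J n).complex.X i

/-- The differentials. -/
noncomputable abbrev dd (n i j : ℕ) : PX J n i →ₗ[R] PX J n j := ((Pr J n).complex.d i j).hom

/-- Components of chain maps. -/
noncomputable abbrev cm {n k : ℕ} (φ : (Pr J k).complex ⟶ (Pr J n).complex) (i : ℕ) :
    PX J k i →ₗ[R] PX J n i := (φ.f i).hom

variable {M i}

def Cocyc {n : ℕ} (f : PX J n i →ₗ[R] M) : Prop := f ∘ₗ dd J n (i+1) i = 0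

def Cobd {n : ℕ} (f : PX J n i →ₗ[R] M) : Prop :=
  ∃ g : PX J n (i-1) →ₗ[R] M, f = g ∘ₗ dd J n i (i-1)

/-- The cocycle `f` represents the class `h`. -/
def LRel {n : ℕ} (f : PX J n i →ₗ[R] M) (h : LC J M i) : Prop :=
  ∃ z, jMap (Pr J n) (ModuleCat.of R M) i z = ModuleCat.ofHom f ∧
    lcι J M i n (qMap (Pr J n) (ModuleCat.of R M) i z) = h

variable {J}

lemma LRel.add {n : ℕ} {f g : PX J n i →ₗ[R] M} {h h' : LC J M i} (H : LRel J f h)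
    (H' : LRel J g h') : LRel J (f + g) (h + h') := by
  obtain ⟨z, e, rfl⟩ := H
  obtain ⟨z', e', rfl⟩ := H'
  refine ⟨z + z', ?_, ?_⟩
  · rw [map_add, e, e']; rfl
  · rw [map_add, map_add]

lemma LRel.smul {n : ℕ} (r : R) {f : PX J n i →ₗ[R] M} {h : LC J M i} (H : LRel J f h) :
    LRel J (r • f) (r • h) := by
  obtain ⟨z, e, rfl⟩ := H
  refine ⟨r • z, ?_, ?_⟩
  · rw [map_smul, e]; rfl
  · rw [map_smul, map_smul]

lemma lrel_exists (h : LC J M i) : ∃ n, ∃ f : PX J n i →ₗ[R] M, LRel J f h := by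
  obtain ⟨n, y, rfl⟩ := lcι_surj J M i h
  obtain ⟨z, rfl⟩ := qMap_surj (Pr J n) (ModuleCat.of R M) i y
  exact ⟨n, (jMap (Pr J n) (ModuleCat.of R M) i z).hom, z, rfl, rfl⟩

lemma LRel.cocyc {n : ℕ} {f : PX J n i →ₗ[R] M} {h : LC J M i} (H : LRel J f h) :
    Cocyc J f := by
  obtain ⟨z, e, rfl⟩ := H
  have := (jMap_range (Pr J n) (ModuleCat.of R M) i (ModuleCat.ofHom f)).1 ⟨z, e⟩
  exact congrArg ModuleCat.Hom.hom this

lemma Cocyc.exists_lrel {n : ℕ} {f : PX J n i →ₗ[R] M} (hf : Cocyc J f) : ∃ h, LRel J f h := by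
  obtain ⟨z, e⟩ := (jMap_range (Pr J n) (ModuleCat.of R M) i (ModuleCat.ofHom f)).2
    (by ext1; exact hf)
  exact ⟨_, z, e, rfl⟩

lemma LRel.pull {n k : ℕ} {f : PX J n i →ₗ[R] M} {h : LC J M i} (H : LRel J f h)
    {φ : (Pr J k).complex ⟶ (Pr J n).complex} (hφ : IsLift J φ) :
    LRel J (f ∘ₗ cm J φ i) h := by
  obtain ⟨z, e, rfl⟩ := H
  obtain ⟨hnk, e2⟩ := hφ
  obtain ⟨z', e3, e4⟩ := ext_nat (Pr J n) (ModuleCat.of R M) i (Pr J k) (trans J hnk) φ e2 z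
  refine ⟨z', ?_, ?_⟩
  · rw [e3, e]; rfl
  · rw [e4, lcι_trans]

lemma LRel.zero {n : ℕ} {f : PX J n i →ₗ[R] M} (H : LRel J f (0 : LC J M i)) :
    ∃ k, ∃ φ : (Pr J k).complex ⟶ (Pr J n).complex, IsLift J φ ∧ Cobd J (f ∘ₗ cm J φ i) := by
  obtain ⟨z, e, e'⟩ := H
  obtain ⟨k, hnk, hk⟩ := lcι_zero J M i _ e'
  obtain ⟨φ, hφ⟩ := exists_lift J hnk
  obtain ⟨z', e3, e4⟩ := ext_nat (Pr J n) (ModuleCat.of R M) i (Pr J k) (trans J hnk) φ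
    hφ.2 z
  rw [hk, qMap_ker] at e4
  obtain ⟨g, hg⟩ := e4
  refine ⟨k, φ, hφ, g.hom, ?_⟩
  rw [e3, e] at hg
  exact (congrArg ModuleCat.Hom.hom hg).symm

lemma Cobd.lrel {n : ℕ} {f : PX J n i →ₗ[R] M} (hf : Cobd J f) : LRel J f (0 : LC J M i) := by
  obtain ⟨g, rfl⟩ := hf
  obtain ⟨z, hz⟩ := (jMap_range (Pr J n) (ModuleCat.of R M) i
    (ModuleCat.ofHom (g ∘ₗ dd J n i (i-1)))).2 (by
      ext1
      have := (Pr J n).complex.d_comp_d (i+1) i (i-1)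
      have := congrArg ModuleCat.Hom.hom this
      change g ∘ₗ (dd J n i (i-1) ∘ₗ dd J n (i+1) i) = 0
      change dd J n i (i-1) ∘ₗ dd J n (i+1) i = 0 at this
      rw [this, LinearMap.comp_zero])
  refine ⟨z, hz, ?_⟩
  rw [(qMap_ker (Pr J n) (ModuleCat.of R M) i z).2 ⟨ModuleCat.ofHom g, by rw [hz]; rfl⟩, map_zero]

lemma LRel.sub {n : ℕ} {f g : PX J n i →ₗ[R] M} {h h' : LC J M i} (H : LRel J f h)
    (H' : LRel J g h') : LRel J (f - g) (h - h') := by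
  have := H.add (H'.smul (-1))
  simpa [sub_eq_add_neg] using this

lemma LRel.uniq {n : ℕ} {f : PX J n i →ₗ[R] M} {h h' : LC J M i} (H : LRel J f h)
    (H' : LRel J f h') : h = h' := by
  obtain ⟨z, e, rfl⟩ := H
  obtain ⟨z', e', rfl⟩ := H'
  rw [jMap_inj _ _ _ (e.trans e'.symm)]

/-- Exactness of the resolutions. -/
lemma dd_exact (n i : ℕ) (p : PX J n (i+1)) (hp : dd J n (i+1) i p = 0) :
    ∃ q, dd J n (i+2) (i+1) q = p := by
  have := (Pr J n).exact_succ i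
  rw [ShortComplex.moduleCat_exact_iff] at this
  exact this p hp

noncomputable def au (n : ℕ) : PX J n 0 →ₗ[R] R ⧸ J ^ n := (aug (Pr J n)).hom

lemma au_exact (n : ℕ) (p : PX J n 0) (hp : au n p = 0) : ∃ q, dd J n 1 0 q = p := by
  have := (Pr J n).exact₀
  rw [ShortComplex.moduleCat_exact_iff] at this
  exact this p hp

lemma au_dd (n : ℕ) : au n ∘ₗ dd J n 1 0 = 0 :=
  congrArg ModuleCat.Hom.hom (Pr J n).complex_d_comp_π_f_zero

lemma au_surj (n : ℕ) : Function.Surjective (au (J := J) n) := by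
  have : Epi ((Pr J n).π.f 0) := inferInstance
  exact (ModuleCat.epi_iff_surjective _).1 this

lemma au_lift {n k : ℕ} {φ : (Pr J k).complex ⟶ (Pr J n).complex} (hφ : IsLift J φ) :
    ∃ h : n ≤ k, au n ∘ₗ cm J φ 0 =
      Submodule.mapQ _ _ LinearMap.id (Ideal.pow_le_pow_right h) ∘ₗ au k :=
  ⟨hφ.1, congrArg ModuleCat.Hom.hom hφ.2⟩

lemma cm_comm {n k : ℕ} (φ : (Pr J k).complex ⟶ (Pr J n).complex) (i j : ℕ) :
    cm J φ j ∘ₗ dd J k i j = dd J n i j ∘ₗ cm J φ i :=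
  congrArg ModuleCat.Hom.hom (φ.comm i j).symm

lemma dd_dd (n i j k : ℕ) : dd J n j k ∘ₗ dd J n i j = 0 :=
  congrArg ModuleCat.Hom.hom ((Pr J n).complex.d_comp_d i j k)

instance px_proj (n i : ℕ) : Module.Projective R (PX J n i) :=
  (IsProjective.iff_projective _).2 ((Pr J n).projective i)

/-- elements of `J^n` kill cocycles up to coboundaries. -/
lemma smul_cobd {n : ℕ} {f : PX J n i →ₗ[R] M} (hf : Cocyc J f) {r : R} (hr : r ∈ J ^ n) :
    Cobd J (r • f) := by
  have hz : (r • 𝟙 (Pr J n).complex) ≫ (Pr J n).π = 0 := by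
    apply HomologicalComplex.to_single_hom_ext
    ext p
    change (au n) (r • p) = 0
    rw [map_smul]
    generalize au n p = t
    obtain ⟨t, rfl⟩ := Submodule.Quotient.mk_surjective _ t
    rw [← Submodule.Quotient.mk_smul, Submodule.Quotient.mk_eq_zero]
    exact Ideal.mul_mem_right _ _ hr
  have H := ProjectiveResolution.liftHomotopyZero _ hz
  have h1 := H.comm i
  have h2 := congrArg ModuleCat.Hom.hom h1
  cases i with
  | zero =>
    refine ⟨0, ?_⟩
    simp only [Homotopy.dNext_zero_chainComplex, Homotopy.prevD_chainComplex, zero_add, HomologicalComplex.zero_f, add_zero] at h2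
    ext p
    have h3 := LinearMap.congr_fun h2 p
    change r • p = dd J n 1 0 ((H.hom 0 1).hom p) at h3
    change r • f p = 0
    rw [← map_smul, h3]
    exact LinearMap.congr_fun hf _
  | succ i =>
    refine ⟨f ∘ₗ (H.hom i (i+1)).hom, ?_⟩
    simp only [Homotopy.dNext_succ_chainComplex, Homotopy.prevD_chainComplex, HomologicalComplex.zero_f, add_zero] at h2
    ext p
    have h3 := LinearMap.congr_fun h2 p
    change r • p = (H.hom i (i+1)).hom (dd J n (i+1) i p) + dd J n (i+2) (i+1) ((H.hom (i+1) (i+2)).hom p) at h3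
    change r • f p = f ((H.hom i (i+1)).hom (dd J n (i+1) i p))
    rw [← map_smul, h3, map_add]
    have := LinearMap.congr_fun hf ((H.hom (i+1) (i+2)).hom p)
    change f (dd J n (i+2) (i+1) _) = 0 at this
    rw [this, add_zero]

end LC
end LCAux

namespace LCAux
open CategoryTheory Limits Opposite

/-- A total and bi-injective relation gives an isomorphism. -/
lemma equivOfRel {R : Type*} [CommRing R] {X Y : Type*} [AddCommGroup X] [Module R X]
    [AddCommGroup Y] [Module R Y] (D : Submodule R (X × Y))
    (h1 : ∀ x, ∃ y, (x, y) ∈ D) (h2 : ∀ y, ∃ x, (x, y) ∈ D)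
    (h3 : ∀ y, ((0 : X), y) ∈ D → y = 0) (h4 : ∀ x, (x, (0 : Y)) ∈ D → x = 0) :
    Nonempty (X ≃ₗ[R] Y) := by
  let f : D →ₗ[R] X := LinearMap.fst R X Y ∘ₗ D.subtype
  let g : D →ₗ[R] Y := LinearMap.snd R X Y ∘ₗ D.subtype
  have hf : Function.Bijective f := by
    constructor
    · rw [← LinearMap.ker_eq_bot, LinearMap.ker_eq_bot']
      rintro ⟨⟨x, y⟩, hxy⟩ h
      change x = 0 at h
      subst h
      have := h3 y hxy
      subst this
      rfl
    · intro x
      obtain ⟨y, hy⟩ := h1 x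
      exact ⟨⟨(x, y), hy⟩, rfl⟩
  have hg : Function.Bijective g := by
    constructor
    · rw [← LinearMap.ker_eq_bot, LinearMap.ker_eq_bot']
      rintro ⟨⟨x, y⟩, hxy⟩ h
      change y = 0 at h
      subst h
      have := h4 x hxy
      subst this
      rfl
    · intro y
      obtain ⟨x, hx⟩ := h2 y
      exact ⟨⟨(x, y), hx⟩, rfl⟩
  exact ⟨(LinearEquiv.ofBijective f hf).symm.trans (LinearEquiv.ofBijective g hg)⟩

section Homol
variable {R : Type u} [CommRing R] {J : Ideal R}
variable {M : Type u} [AddCommGroup M] [Module R M]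
variable {N : Type u} [AddCommGroup N] [Module R N]
variable {A : Type u} [AddCommGroup A] [Module R A]
variable {B : Type u} [AddCommGroup B] [Module R B]
variable {C : Type u} [AddCommGroup C] [Module R C] {i n k : ℕ}

lemma Cocyc.pull {f : PX J n i →ₗ[R] M} (hf : Cocyc J f)
    (φ : (Pr J k).complex ⟶ (Pr J n).complex) : Cocyc J (f ∘ₗ cm J φ i) := by
  unfold Cocyc at *
  rw [LinearMap.comp_assoc, cm_comm, ← LinearMap.comp_assoc, hf, LinearMap.zero_comp]

lemma Cobd.pull {f : PX J n i →ₗ[R] M} (hf : Cobd J f)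
    (φ : (Pr J k).complex ⟶ (Pr J n).complex) : Cobd J (f ∘ₗ cm J φ i) := by
  obtain ⟨g, rfl⟩ := hf
  exact ⟨g ∘ₗ cm J φ (i-1), by rw [LinearMap.comp_assoc, ← cm_comm, LinearMap.comp_assoc]⟩

lemma Cobd.add {f g : PX J n i →ₗ[R] M} (hf : Cobd J f) (hg : Cobd J g) : Cobd J (f + g) := by
  obtain ⟨f, rfl⟩ := hf
  obtain ⟨g, rfl⟩ := hg
  exact ⟨f + g, by rw [LinearMap.add_comp]⟩

lemma Cobd.sub {f g : PX J n i →ₗ[R] M} (hf : Cobd J f) (hg : Cobd J g) : Cobd J (f - g) := by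
  obtain ⟨f, rfl⟩ := hf
  obtain ⟨g, rfl⟩ := hg
  exact ⟨f - g, by rw [LinearMap.sub_comp]⟩

lemma Cocyc.sub {f g : PX J n i →ₗ[R] M} (hf : Cocyc J f) (hg : Cocyc J g) :
    Cocyc J (f - g) := by
  unfold Cocyc at *
  rw [LinearMap.sub_comp, hf, hg, sub_zero]

lemma Cobd.map {f : PX J n i →ₗ[R] M} (hf : Cobd J f) (g : M →ₗ[R] N) : Cobd J (g ∘ₗ f) := by
  obtain ⟨f, rfl⟩ := hf
  exact ⟨g ∘ₗ f, by rw [LinearMap.comp_assoc]⟩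

lemma Cocyc.map {f : PX J n i →ₗ[R] M} (hf : Cocyc J f) (g : M →ₗ[R] N) :
    Cocyc J (g ∘ₗ f) := by
  unfold Cocyc at *
  rw [LinearMap.comp_assoc, hf, LinearMap.comp_zero]

lemma Cobd.cocyc {f : PX J n i →ₗ[R] M} (hf : Cobd J f) : Cocyc J f := by
  obtain ⟨g, rfl⟩ := hf
  unfold Cocyc
  rw [LinearMap.comp_assoc, dd_dd, LinearMap.comp_zero]

lemma Cobd.lift {β : B →ₗ[R] C} (hβ : Function.Surjective β) {f : PX J n i →ₗ[R] C}
    (hf : Cobd J f) : ∃ f' : PX J n i →ₗ[R] B, Cobd J f' ∧ β ∘ₗ f' = f := by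
  obtain ⟨g, rfl⟩ := hf
  obtain ⟨g', rfl⟩ := Module.projective_lifting_property β g hβ
  exact ⟨g' ∘ₗ dd J n i (i-1), ⟨g', rfl⟩, rfl⟩

lemma LRel.cobd {f : PX J n i →ₗ[R] M} {h : LC J M i} (H : LRel J f h) (hf : Cobd J f) : h = 0 :=
  H.uniq hf.lrel

/-- Vanishing of local cohomology, elementwise. -/
def Van (J : Ideal R) (i : ℕ) (M : Type u) [AddCommGroup M] [Module R M] : Prop :=
  ∀ (n : ℕ) (f : PX J n i →ₗ[R] M), Cocyc J f →
    ∃ k, ∃ φ : (Pr J k).complex ⟶ (Pr J n).complex, IsLift J φ ∧ Cobd J (f ∘ₗ cm J φ i)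

lemma factor {P : Type*} [AddCommGroup P] [Module R P] {α : A →ₗ[R] B} {β : B →ₗ[R] C}
    (hα : Function.Injective α) (hex : Function.Exact α β) (f : P →ₗ[R] B) (hf : β ∘ₗ f = 0) :
    ∃ g : P →ₗ[R] A, α ∘ₗ g = f := by
  have hr : ∀ p, f p ∈ LinearMap.range α := fun p =>
    (hex (f p)).1 (LinearMap.congr_fun hf p)
  refine ⟨(LinearEquiv.ofInjective α hα).symm.toLinearMap ∘ₗ f.codRestrict _ hr, ?_⟩
  ext p
  have := LinearEquiv.apply_symm_apply (LinearEquiv.ofInjective α hα) (f.codRestrict _ hr p)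
  exact congrArg Subtype.val this

lemma exists_common {n₁ n₂ : ℕ} : ∃ k, ∃ φ₁ : (Pr J k).complex ⟶ (Pr J n₁).complex,
    ∃ φ₂ : (Pr J k).complex ⟶ (Pr J n₂).complex, IsLift J φ₁ ∧ IsLift J φ₂ := by
  obtain ⟨φ₁, h₁⟩ := exists_lift J (le_max_left n₁ n₂)
  obtain ⟨φ₂, h₂⟩ := exists_lift J (le_max_right n₁ n₂)
  exact ⟨_, φ₁, φ₂, h₁, h₂⟩

lemma cm_comp {l : ℕ} (φ : (Pr J k).complex ⟶ (Pr J n).complex)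
    (ψ : (Pr J l).complex ⟶ (Pr J k).complex) (i : ℕ) :
    cm J (ψ ≫ φ) i = cm J φ i ∘ₗ cm J ψ i := rfl

variable {α : A →ₗ[R] B} {β : B →ₗ[R] C}

lemma inj_comp {P : Type*} [AddCommGroup P] [Module R P]
    (hα : Function.Injective α) {f g : P →ₗ[R] A} (h : α ∘ₗ f = α ∘ₗ g) : f = g := by
  ext p
  exact hα (LinearMap.congr_fun h p)

lemma Van.shift (hα : Function.Injective α) (hβ : Function.Surjective β)
    (hex : Function.Exact α β) (hC : Van J i C) (hB : Van J (i+1) B) : Van J (i+1) A := by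
  intro n f hf
  obtain ⟨k, φ, hφ, g, hg⟩ := hB n (α ∘ₗ f) (hf.map α)
  change PX J k i →ₗ[R] B at g
  change _ = g ∘ₗ dd J k (i+1) i at hg
  have hc : Cocyc J (β ∘ₗ g) := by
    unfold Cocyc
    rw [LinearMap.comp_assoc, ← hg, ← LinearMap.comp_assoc, ← LinearMap.comp_assoc,
      hex.linearMap_comp_eq_zero, LinearMap.zero_comp, LinearMap.zero_comp]
  obtain ⟨l, ψ, hψ, hcb⟩ := hC k _ hc
  obtain ⟨b', hb', hbe⟩ := hcb.lift hβ
  obtain ⟨a, ha⟩ := factor hα hex (g ∘ₗ cm J ψ i - b') (by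
    rw [LinearMap.comp_sub, hbe, LinearMap.comp_assoc, sub_self])
  refine ⟨l, ψ ≫ φ, IsLift.comp J hφ hψ, a, ?_⟩
  apply inj_comp hα
  change α ∘ₗ f ∘ₗ (cm J φ (i+1) ∘ₗ cm J ψ (i+1)) = α ∘ₗ a ∘ₗ dd J l (i+1) i
  rw [← LinearMap.comp_assoc, ← LinearMap.comp_assoc, hg,
    ← LinearMap.comp_assoc, ha, LinearMap.sub_comp, LinearMap.comp_assoc, LinearMap.comp_assoc,
    cm_comm, hb'.cocyc, sub_zero]

lemma Van.middle (hα : Function.Injective α) (hβ : Function.Surjective β)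
    (hex : Function.Exact α β) (hA : Van J i A) (hC : Van J i C) : Van J i B := by
  intro n f hf
  obtain ⟨k, φ, hφ, hcb⟩ := hC n (β ∘ₗ f) (hf.map β)
  obtain ⟨b', hb', hbe⟩ := hcb.lift hβ
  obtain ⟨a, ha⟩ := factor hα hex (f ∘ₗ cm J φ i - b') (by
    rw [LinearMap.comp_sub, hbe, LinearMap.comp_assoc, sub_self])
  have hac : Cocyc J a := by
    apply inj_comp hα
    rw [← LinearMap.comp_assoc, ha, LinearMap.comp_zero]
    exact (hf.pull φ).sub hb'.cocyc
  obtain ⟨l, ψ, hψ, hab⟩ := hA k a hac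
  refine ⟨l, ψ ≫ φ, IsLift.comp J hφ hψ, ?_⟩
  rw [cm_comp]
  have h := (hab.map α).add (hb'.pull ψ)
  rw [← LinearMap.comp_assoc _ _ α, ha, LinearMap.sub_comp, sub_add_cancel] at h
  exact h

lemma Van.equiv (e : M ≃ₗ[R] N) (h : Van J i M) : Van J i N := by
  intro n f hf
  obtain ⟨k, φ, hφ, hc⟩ := h n _ (hf.map e.symm.toLinearMap)
  refine ⟨k, φ, hφ, ?_⟩
  have := hc.map e.toLinearMap
  rwa [← LinearMap.comp_assoc, ← LinearMap.comp_assoc, LinearEquiv.comp_symm,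
    LinearMap.id_comp] at this

/-- `LC i B ≃ LC i C` when the cohomology of the kernel vanishes. -/
lemma iso_quot (hα : Function.Injective α) (hβ : Function.Surjective β)
    (hex : Function.Exact α β) (hA : Van J i A) (hA' : Van J (i+1) A) :
    Nonempty (LC J B i ≃ₗ[R] LC J C i) := by
  let D : Submodule R (LC J B i × LC J C i) :=
    { carrier := {h | ∃ n, ∃ f : PX J n i →ₗ[R] B, LRel J f h.1 ∧ LRel J (β ∘ₗ f) h.2}
      add_mem' := by
        rintro ⟨x, y⟩ ⟨x', y'⟩ ⟨n, f, h1, h2⟩ ⟨n', f', h1', h2'⟩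
        obtain ⟨k, φ, φ', hφ, hφ'⟩ := exists_common (J := J) (n₁ := n) (n₂ := n')
        refine ⟨k, f ∘ₗ cm J φ i + f' ∘ₗ cm J φ' i, (h1.pull hφ).add (h1'.pull hφ'), ?_⟩
        have := (h2.pull hφ).add (h2'.pull hφ')
        rw [LinearMap.comp_add]
        exact this
      zero_mem' := ⟨0, 0, Cobd.lrel ⟨0, by simp⟩, Cobd.lrel ⟨0, by simp⟩⟩
      smul_mem' := by
        rintro r ⟨x, y⟩ ⟨n, f, h1, h2⟩
        exact ⟨n, r • f, h1.smul r, by rw [LinearMap.comp_smul]; exact h2.smul r⟩ }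
  refine equivOfRel D ?_ ?_ ?_ ?_
  · intro x
    obtain ⟨n, f, hf⟩ := lrel_exists x
    obtain ⟨y, hy⟩ := (hf.cocyc.map β).exists_lrel
    exact ⟨y, n, f, hf, hy⟩
  · intro y
    obtain ⟨n, c, hc⟩ := lrel_exists y
    obtain ⟨b, hb⟩ := Module.projective_lifting_property β c hβ
    obtain ⟨a, ha⟩ := factor hα hex (b ∘ₗ dd J n (i+1) i) (by
      rw [← LinearMap.comp_assoc, hb]; exact hc.cocyc)
    have hac : Cocyc J a := by
      apply inj_comp hα
      rw [← LinearMap.comp_assoc, ha, LinearMap.comp_assoc, dd_dd, LinearMap.comp_zero,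
        LinearMap.comp_zero]
    obtain ⟨k, φ, hφ, g, hg⟩ := hA' n a hac
    change PX J k i →ₗ[R] A at g
    change _ = g ∘ₗ dd J k (i+1) i at hg
    have hcc : Cocyc J (b ∘ₗ cm J φ i - α ∘ₗ g) := by
      unfold Cocyc
      rw [LinearMap.sub_comp, LinearMap.comp_assoc, LinearMap.comp_assoc, ← hg, cm_comm,
        ← LinearMap.comp_assoc, ← LinearMap.comp_assoc, ha, sub_self]
    obtain ⟨x, hx⟩ := hcc.exists_lrel
    refine ⟨x, k, _, hx, ?_⟩
    rw [LinearMap.comp_sub, ← LinearMap.comp_assoc, ← LinearMap.comp_assoc,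
      hex.linearMap_comp_eq_zero, hb, LinearMap.zero_comp, sub_zero]
    exact hc.pull hφ
  · rintro y ⟨n, f, h1, h2⟩
    obtain ⟨k, φ, hφ, hc⟩ := h1.zero
    exact (h2.pull hφ).cobd (hc.map β)
  · rintro x ⟨n, f, h1, h2⟩
    obtain ⟨k, φ, hφ, hc⟩ := h2.zero
    obtain ⟨b', hb', hbe⟩ := hc.lift hβ
    obtain ⟨a, ha⟩ := factor hα hex (f ∘ₗ cm J φ i - b') (by
      rw [LinearMap.comp_sub, hbe, LinearMap.comp_assoc, sub_self])
    have hac : Cocyc J a := by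
      apply inj_comp hα
      rw [← LinearMap.comp_assoc, ha, LinearMap.comp_zero]
      exact (h1.cocyc.pull φ).sub hb'.cocyc
    obtain ⟨l, ψ, hψ, hab⟩ := hA k a hac
    refine ((h1.pull hφ).pull hψ).cobd ?_
    have h := (hab.map α).add (hb'.pull ψ)
    rw [← LinearMap.comp_assoc _ _ α, ha, LinearMap.sub_comp, sub_add_cancel] at h
    exact h

/-- `LC i C ≃ LC (i+1) A` when the cohomology of the middle vanishes. -/
lemma iso_shift (hα : Function.Injective α) (hβ : Function.Surjective β)
    (hex : Function.Exact α β) (hB : Van J i B) (hB' : Van J (i+1) B) :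
    Nonempty (LC J C i ≃ₗ[R] LC J A (i+1)) := by
  let D : Submodule R (LC J C i × LC J A (i+1)) :=
    { carrier := {h | ∃ n, ∃ b : PX J n i →ₗ[R] B, ∃ a : PX J n (i+1) →ₗ[R] A,
        α ∘ₗ a = b ∘ₗ dd J n (i+1) i ∧ LRel J (β ∘ₗ b) h.1 ∧ LRel J a h.2}
      add_mem' := by
        rintro ⟨x, y⟩ ⟨x', y'⟩ ⟨n, b, a, e, h1, h2⟩ ⟨n', b', a', e', h1', h2'⟩
        obtain ⟨k, φ, φ', hφ, hφ'⟩ := exists_common (J := J) (n₁ := n) (n₂ := n')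
        refine ⟨k, b ∘ₗ cm J φ i + b' ∘ₗ cm J φ' i, a ∘ₗ cm J φ (i+1) + a' ∘ₗ cm J φ' (i+1),
          ?_, ?_, (h2.pull hφ).add (h2'.pull hφ')⟩
        · rw [LinearMap.comp_add, LinearMap.add_comp, ← LinearMap.comp_assoc,
            ← LinearMap.comp_assoc, e, e', LinearMap.comp_assoc, LinearMap.comp_assoc,
            LinearMap.comp_assoc, LinearMap.comp_assoc, cm_comm, cm_comm]
        · have := (h1.pull hφ).add (h1'.pull hφ')
          rw [LinearMap.comp_add]
          exact this
      zero_mem' := ⟨0, 0, 0, by simp, Cobd.lrel ⟨0, by simp⟩, Cobd.lrel ⟨0, by simp⟩⟩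
      smul_mem' := by
        rintro r ⟨x, y⟩ ⟨n, b, a, e, h1, h2⟩
        exact ⟨n, r • b, r • a, by rw [LinearMap.comp_smul, LinearMap.smul_comp, e],
          by rw [LinearMap.comp_smul]; exact h1.smul r, h2.smul r⟩ }
  refine equivOfRel D ?_ ?_ ?_ ?_
  · intro x
    obtain ⟨n, c, hc⟩ := lrel_exists x
    obtain ⟨b, hb⟩ := Module.projective_lifting_property β c hβ
    obtain ⟨a, ha⟩ := factor hα hex (b ∘ₗ dd J n (i+1) i) (by
      rw [← LinearMap.comp_assoc, hb]; exact hc.cocyc)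
    have hac : Cocyc J a := by
      apply inj_comp hα
      rw [← LinearMap.comp_assoc, ha, LinearMap.comp_assoc, dd_dd, LinearMap.comp_zero,
        LinearMap.comp_zero]
    obtain ⟨y, hy⟩ := hac.exists_lrel
    exact ⟨y, n, b, a, ha, by rw [hb]; exact hc, hy⟩
  · intro y
    obtain ⟨n, a, ha⟩ := lrel_exists y
    obtain ⟨k, φ, hφ, b, hb⟩ := hB' n _ (ha.cocyc.map α)
    change PX J k i →ₗ[R] B at b
    change _ = b ∘ₗ dd J k (i+1) i at hb
    have hbc : Cocyc J (β ∘ₗ b) := by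
      unfold Cocyc
      rw [LinearMap.comp_assoc, ← hb, ← LinearMap.comp_assoc, ← LinearMap.comp_assoc,
        hex.linearMap_comp_eq_zero, LinearMap.zero_comp, LinearMap.zero_comp]
    obtain ⟨x, hx⟩ := hbc.exists_lrel
    exact ⟨x, k, b, a ∘ₗ cm J φ (i+1), by rw [← LinearMap.comp_assoc, hb], hx, ha.pull hφ⟩
  · rintro y ⟨n, b, a, e, h1, h2⟩
    obtain ⟨k, φ, hφ, hc⟩ := h1.zero
    obtain ⟨b', hb', hbe⟩ := hc.lift hβ
    obtain ⟨g, hg⟩ := factor hα hex (b ∘ₗ cm J φ i - b') (by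
      rw [LinearMap.comp_sub, hbe, LinearMap.comp_assoc, sub_self])
    refine (h2.pull hφ).cobd ⟨g, ?_⟩
    apply inj_comp hα
    change _ = α ∘ₗ (g ∘ₗ dd J k (i+1) i)
    rw [← LinearMap.comp_assoc, ← LinearMap.comp_assoc, hg, e, LinearMap.comp_assoc, ← cm_comm,
      LinearMap.sub_comp, hb'.cocyc, sub_zero, LinearMap.comp_assoc]
  · rintro x ⟨n, b, a, e, h1, h2⟩
    obtain ⟨k, φ, hφ, g, hg⟩ := h2.zero
    change PX J k i →ₗ[R] A at g
    change _ = g ∘ₗ dd J k (i+1) i at hg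
    have hcc : Cocyc J (b ∘ₗ cm J φ i - α ∘ₗ g) := by
      unfold Cocyc
      rw [LinearMap.sub_comp, LinearMap.comp_assoc, LinearMap.comp_assoc, ← hg, cm_comm,
        ← LinearMap.comp_assoc, ← LinearMap.comp_assoc, e, sub_self]
    obtain ⟨l, ψ, hψ, hcb⟩ := hB k _ hcc
    refine ((h1.pull hφ).pull hψ).cobd ?_
    have := hcb.map β
    rw [← LinearMap.comp_assoc, LinearMap.comp_sub, ← LinearMap.comp_assoc,
      ← LinearMap.comp_assoc _ α β, hex.linearMap_comp_eq_zero, LinearMap.zero_comp, sub_zero] at this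
    exact this

end Homol
end LCAux

namespace LCAux
open CategoryTheory Limits Opposite

section Van
variable {R : Type u} [CommRing R] {J : Ideal R}
variable {M : Type u} [AddCommGroup M] [Module R M]
variable {A : Type u} [AddCommGroup A] [Module R A]
variable {B : Type u} [AddCommGroup B] [Module R B]
variable {C : Type u} [AddCommGroup C] [Module R C] {i n k : ℕ}
variable {α : A →ₗ[R] B} {β : B →ₗ[R] C}

lemma van_shift' (hα : Function.Injective α)
    (hex : Function.Exact α β) (hC : ∀ (n : ℕ) (f : PX J n i →ₗ[R] C), Cocyc J f →
      ∃ k, ∃ φ : (Pr J k).complex ⟶ (Pr J n).complex, IsLift J φ ∧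
        ∃ b : PX J k i →ₗ[R] B, Cocyc J b ∧ β ∘ₗ b = f ∘ₗ cm J φ i)
    (hB : Van J (i+1) B) : Van J (i+1) A := by
  intro n f hf
  obtain ⟨k, φ, hφ, g, hg⟩ := hB n (α ∘ₗ f) (hf.map α)
  change PX J k i →ₗ[R] B at g
  change _ = g ∘ₗ dd J k (i+1) i at hg
  have hc : Cocyc J (β ∘ₗ g) := by
    unfold Cocyc
    rw [LinearMap.comp_assoc, ← hg, ← LinearMap.comp_assoc, ← LinearMap.comp_assoc,
      hex.linearMap_comp_eq_zero, LinearMap.zero_comp, LinearMap.zero_comp]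
  obtain ⟨l, ψ, hψ, b', hb', hbe⟩ := hC k _ hc
  obtain ⟨a, ha⟩ := factor hα hex (g ∘ₗ cm J ψ i - b') (by
    rw [LinearMap.comp_sub, hbe, LinearMap.comp_assoc, sub_self])
  refine ⟨l, ψ ≫ φ, IsLift.comp J hφ hψ, a, ?_⟩
  apply inj_comp hα
  change α ∘ₗ f ∘ₗ (cm J φ (i+1) ∘ₗ cm J ψ (i+1)) = α ∘ₗ a ∘ₗ dd J l (i+1) i
  rw [← LinearMap.comp_assoc, ← LinearMap.comp_assoc, hg,
    ← LinearMap.comp_assoc, ha, LinearMap.sub_comp, LinearMap.comp_assoc, LinearMap.comp_assoc,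
    cm_comm, hb', sub_zero]

lemma inj_extend {E X Y : Type u} [AddCommGroup E] [Module R E] [AddCommGroup X] [Module R X]
    [AddCommGroup Y] [Module R Y] [hE : Module.Injective R E] (p : X →ₗ[R] Y) (f : X →ₗ[R] E)
    (h : LinearMap.ker p ≤ LinearMap.ker f) : ∃ g : Y →ₗ[R] E, g ∘ₗ p = f := by
  obtain ⟨g, hg⟩ := hE.out ((LinearMap.ker p).liftQ p le_rfl)
    (by rw [← LinearMap.ker_eq_bot, Submodule.ker_liftQ_eq_bot' _ _ rfl])
    ((LinearMap.ker p).liftQ f h)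
  refine ⟨g, ?_⟩
  ext x
  exact hg (Submodule.Quotient.mk x)

lemma van_injective (E : Type u) [AddCommGroup E] [Module R E] [Module.Injective R E] (i : ℕ) :
    Van J (i+1) E := by
  intro n f hf
  obtain ⟨g, hg⟩ := inj_extend (dd J n (i+1) i) f (by
    intro p hp
    obtain ⟨q, rfl⟩ := dd_exact n i p hp
    exact LinearMap.congr_fun hf q)
  exact ⟨n, 𝟙 _, isLift_id J n, g, hg.symm⟩

/-- Torsion modules. -/
def Tors (J : Ideal R) (T : Type u) [AddCommGroup T] [Module R T] : Prop :=
  ∀ t : T, ∃ n, ∀ r ∈ J ^ n, r • t = 0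

/-- The `J`-torsion submodule. -/
def gam (J : Ideal R) (E : Type u) [AddCommGroup E] [Module R E] : Submodule R E where
  carrier := {t | ∃ n, ∀ r ∈ J ^ n, r • t = 0}
  add_mem' := by
    rintro a b ⟨n, hn⟩ ⟨k, hk⟩
    refine ⟨n + k, fun r hr => ?_⟩
    rw [smul_add, hn r (Ideal.pow_le_pow_right (by omega) hr),
      hk r (Ideal.pow_le_pow_right (by omega) hr), add_zero]
  zero_mem' := ⟨0, fun r _ => smul_zero r⟩
  smul_mem' := by
    rintro c a ⟨n, hn⟩
    exact ⟨n, fun r hr => by rw [smul_comm, hn r hr, smul_zero]⟩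

lemma gam_injective [IsNoetherianRing R] (E : Type u) [AddCommGroup E] [Module R E]
    [Module.Injective R E] : Module.Injective R (gam J E) := by
  apply Module.Baer.injective
  intro I g
  classical
  have h1 : ∃ n, ∀ r ∈ J ^ n, ∀ a : I, r • g a = 0 := by
    obtain ⟨s, hs⟩ : (⊤ : Submodule R I).FG := IsNoetherian.noetherian _
    have : ∀ t : Finset I, ∃ n, ∀ r ∈ J ^ n, ∀ a ∈ t, r • g a = 0 := by
      intro t
      induction t using Finset.induction_on with
      | empty => exact ⟨0, by simp⟩
      | insert a t _ ih =>
        obtain ⟨n, hn⟩ := ih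
        obtain ⟨k, hk⟩ := (g a).2
        refine ⟨n + k, fun r hr b hb => ?_⟩
        rcases Finset.mem_insert.1 hb with rfl | hb
        · exact Subtype.ext (hk r (Ideal.pow_le_pow_right (by omega) hr))
        · exact hn r (Ideal.pow_le_pow_right (by omega) hr) b hb
    obtain ⟨n, hn⟩ := this s
    refine ⟨n, fun r hr a => ?_⟩
    have ha : a ∈ Submodule.span R (s : Set I) := hs ▸ Submodule.mem_top
    induction ha using Submodule.span_induction with
    | mem x hx => exact hn r hr x hx
    | zero => simp
    | add x y _ _ hx hy => rw [map_add, smul_add, hx, hy, add_zero]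
    | smul c x _ hx => rw [map_smul, smul_comm, hx, smul_zero]
  obtain ⟨n, hn⟩ := h1
  obtain ⟨k, hk⟩ := Ideal.exists_pow_inf_eq_pow_smul J (I : Submodule R R)
  have hk2 := hk (n + k) (by omega)
  have hI : ∀ a : I, (a : R) ∈ J ^ (n + k) → g a = 0 := by
    intro a ha
    have h2 : (a : R) ∈ J ^ (n + k) • (⊤ : Submodule R R) ⊓ (I : Submodule R R) :=
      ⟨by simpa using ha, a.2⟩
    rw [hk2] at h2
    have h3 : (a : R) ∈ J ^ n • (I : Submodule R R) := by
      refine Submodule.smul_mono ?_ inf_le_right h2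
      exact Ideal.pow_le_pow_right (by omega)
    have h4 : ∃ hb : (a : R) ∈ I, g ⟨a, hb⟩ = 0 := by
      refine Submodule.smul_induction_on (p := fun b => ∃ hb : b ∈ I, g ⟨b, hb⟩ = 0) h3 ?_ ?_
      · intro r hr b hb
        refine ⟨I.mul_mem_left r hb, ?_⟩
        have := hn r hr ⟨b, hb⟩
        rw [← map_smul] at this
        exact this
      · rintro x y ⟨hx, hx'⟩ ⟨hy, hy'⟩
        refine ⟨I.add_mem hx hy, ?_⟩
        have := map_add g ⟨x, hx⟩ ⟨y, hy⟩
        rw [hx', hy', add_zero] at this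
        exact this
    exact h4.2
  obtain ⟨H, hH⟩ := inj_extend ((Submodule.mkQ (J ^ (n + k))) ∘ₗ Submodule.subtype I)
    ((gam J E).subtype ∘ₗ g) (by
      intro a ha
      have : (a : R) ∈ J ^ (n + k) := by
        have h5 : Submodule.mkQ (J ^ (n + k)) (a : R) = 0 := ha
        exact (Submodule.Quotient.mk_eq_zero _).1 h5
      change ((g a : gam J E) : E) = 0
      rw [hI a this]; rfl)
  have h6 : H (Submodule.mkQ (J ^ (n+k)) 1) ∈ gam J E := by
    refine ⟨n + k, fun r hr => ?_⟩
    rw [← map_smul, ← map_smul]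
    have : Submodule.mkQ (J ^ (n+k)) (r • 1) = 0 :=
      (Submodule.Quotient.mk_eq_zero _).2 (by simpa using hr)
    rw [this, map_zero]
  refine ⟨LinearMap.toSpanSingleton R _ ⟨_, h6⟩, ?_⟩
  intro a ha
  apply Subtype.ext
  have := LinearMap.congr_fun hH ⟨a, ha⟩
  change H (Submodule.mkQ (J ^ (n+k)) a) = _ at this
  change a • H (Submodule.mkQ (J ^ (n+k)) 1) = _
  rw [← map_smul, ← map_smul, smul_eq_mul, mul_one, this]
  rfl

lemma exists_cocyc_zero {u : M} (n : ℕ) (hu : ∀ r ∈ J ^ n, r • u = 0) :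
    ∃ f : PX J n 0 →ₗ[R] M, Cocyc J f ∧ ∀ p r, au n p = Submodule.Quotient.mk r → f p = r • u := by
  refine ⟨(Submodule.liftQ (J ^ n) (LinearMap.toSpanSingleton R M u) hu) ∘ₗ au n, ?_, ?_⟩
  · unfold Cocyc
    rw [LinearMap.comp_assoc, au_dd, LinearMap.comp_zero]
  · intro p r h
    rw [LinearMap.comp_apply, h]
    rfl

lemma Cocyc.zero_rep {f : PX J n 0 →ₗ[R] M} (hf : Cocyc J f) :
    ∃ u : M, (∀ p r, au n p = Submodule.Quotient.mk r → f p = r • u) := by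
  obtain ⟨p0, hp0⟩ := au_surj n (Submodule.Quotient.mk (1 : R) : R ⧸ J ^ n)
  refine ⟨f p0, fun p r h => ?_⟩
  obtain ⟨q, hq⟩ := au_exact n (p - r • p0) (by
    rw [map_sub, map_smul, hp0, h, ← Submodule.Quotient.mk_smul, smul_eq_mul, mul_one, sub_self])
  have := LinearMap.congr_fun hf q
  change f (dd J n 1 0 q) = 0 at this
  rw [hq, map_sub, map_smul, sub_eq_zero] at this
  exact this

lemma au_lift_mk {φ : (Pr J k).complex ⟶ (Pr J n).complex} (hφ : IsLift J φ) {p r}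
    (h : au k p = Submodule.Quotient.mk r) : au n (cm J φ 0 p) = Submodule.Quotient.mk r := by
  obtain ⟨_, e⟩ := au_lift hφ
  have := LinearMap.congr_fun e p
  rw [LinearMap.comp_apply, LinearMap.comp_apply, h] at this
  exact this

lemma exists_inj_embed (T : Type u) [AddCommGroup T] [Module R T] :
    ∃ (E : Type u) (_ : AddCommGroup E) (_ : Module R E) (_ : Module.Injective R E)
      (ι : T →ₗ[R] E), Function.Injective ι := by
  have hinj : Injective (Injective.under (ModuleCat.of R T)) := inferInstance
  refine ⟨((Injective.under (ModuleCat.of R T) : ModuleCat.{u} R) : Type u), inferInstance, inferInstance, ?_,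
    (Injective.ι (ModuleCat.of R T)).hom, (ModuleCat.mono_iff_injective _).1 inferInstance⟩
  exact (Module.injective_iff_injective_object R _).2 hinj

lemma van_tors [IsNoetherianRing R] (i : ℕ) : ∀ (T : Type u) [AddCommGroup T] [Module R T],
    Tors J T → Van J (i+1) T := by
  induction i with
  | zero =>
    intro T _ _ hT
    obtain ⟨E, _, _, _, ι, hι⟩ := exists_inj_embed (R := R) T
    let α : T →ₗ[R] gam J E := ι.codRestrict _ (fun t => by
      obtain ⟨n, hn⟩ := hT t
      exact ⟨n, fun r hr => by rw [← map_smul, hn r hr, map_zero]⟩)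
    have hα : Function.Injective α := fun a b h => hι (congrArg Subtype.val h)
    have := gam_injective (J := J) E
    refine van_shift' (β := (LinearMap.range α).mkQ) hα
      (LinearMap.exact_iff.2 (Submodule.ker_mkQ _)) ?_ (van_injective _ 0)
    intro n f hf
    obtain ⟨c, hc⟩ := hf.zero_rep
    obtain ⟨e, rfl⟩ := Submodule.mkQ_surjective _ c
    obtain ⟨k, hk⟩ := e.2
    obtain ⟨φ, hφ⟩ := exists_lift J (show n ≤ n + k by omega)
    obtain ⟨b, hb, hb'⟩ := exists_cocyc_zero (J := J) (u := e) (n + k) (fun r hr =>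
      Subtype.ext (hk r (Ideal.pow_le_pow_right (by omega) hr)))
    refine ⟨n + k, φ, hφ, b, hb, ?_⟩
    ext p
    obtain ⟨r, hr⟩ := Submodule.Quotient.mk_surjective _ (au (n+k) p)
    change (LinearMap.range α).mkQ (b p) = f (cm J φ 0 p)
    rw [hb' p r hr.symm, hc _ r (au_lift_mk hφ hr.symm), map_smul]
  | succ i ih =>
    intro T _ _ hT
    obtain ⟨E, _, _, _, ι, hι⟩ := exists_inj_embed (R := R) T
    let α : T →ₗ[R] gam J E := ι.codRestrict _ (fun t => by
      obtain ⟨n, hn⟩ := hT t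
      exact ⟨n, fun r hr => by rw [← map_smul, hn r hr, map_zero]⟩)
    have hα : Function.Injective α := fun a b h => hι (congrArg Subtype.val h)
    have := gam_injective (J := J) E
    refine Van.shift (β := (LinearMap.range α).mkQ) hα (Submodule.mkQ_surjective _)
      (LinearMap.exact_iff.2 (Submodule.ker_mkQ _)) (ih _ ?_) (van_injective _ _)
    intro c
    obtain ⟨e, rfl⟩ := Submodule.mkQ_surjective _ c
    obtain ⟨k, hk⟩ := e.2
    refine ⟨k, fun r hr => ?_⟩
    rw [← map_smul, show r • e = 0 from Subtype.ext (hk r hr), map_zero]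

lemma van_bij {x : R} (hx : x ∈ J) (hb : Function.Bijective (fun v : M => x • v)) (i : ℕ) :
    Van J i M := by
  intro n f hf
  have hbn : Function.Bijective (LinearMap.lsmul R M (x ^ n)) := by
    have : (LinearMap.lsmul R M (x ^ n) : M → M) = (fun v : M => x • v)^[n] := by
      funext v
      induction n generalizing v with
      | zero => simp
      | succ n ih =>
        have := (ih 0 (by simp [Cocyc]) v)
        rw [Function.iterate_succ_apply', ← this]
        simp [pow_succ', mul_smul]
    rw [this]
    exact hb.iterate n
  let e := LinearEquiv.ofBijective _ hbn
  refine ⟨n, 𝟙 _, isLift_id J n, ?_⟩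
  have h := (smul_cobd hf (Ideal.pow_mem_pow hx n)).map e.symm.toLinearMap
  convert h using 1
  ext p
  change f p = e.symm (x ^ n • f p)
  rw [LinearEquiv.eq_symm_apply]
  rfl

lemma iso_zero (hM : Tors J M) : Nonempty (LC J M 0 ≃ₗ[R] M) := by
  let D : Submodule R (LC J M 0 × M) :=
    { carrier := {h | ∃ n, ∃ f : PX J n 0 →ₗ[R] M, LRel J f h.1 ∧
        ∀ p r, au n p = Submodule.Quotient.mk r → f p = r • h.2}
      add_mem' := by
        rintro ⟨x, y⟩ ⟨x', y'⟩ ⟨n, f, h1, h2⟩ ⟨n', f', h1', h2'⟩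
        obtain ⟨k, φ, φ', hφ, hφ'⟩ := exists_common (J := J) (n₁ := n) (n₂ := n')
        refine ⟨k, f ∘ₗ cm J φ 0 + f' ∘ₗ cm J φ' 0, (h1.pull hφ).add (h1'.pull hφ'), ?_⟩
        intro p r h
        change f (cm J φ 0 p) + f' (cm J φ' 0 p) = r • (y + y')
        rw [h2 _ r (au_lift_mk hφ h), h2' _ r (au_lift_mk hφ' h), smul_add]
      zero_mem' := ⟨0, 0, Cobd.lrel ⟨0, by simp⟩, by simp⟩
      smul_mem' := by
        rintro c ⟨x, y⟩ ⟨n, f, h1, h2⟩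
        refine ⟨n, c • f, h1.smul c, fun p r h => ?_⟩
        change c • f p = r • (c • y)
        rw [h2 p r h, smul_comm] }
  refine equivOfRel D ?_ ?_ ?_ ?_
  · intro x
    obtain ⟨n, f, hf⟩ := lrel_exists x
    obtain ⟨u, hu⟩ := hf.cocyc.zero_rep
    exact ⟨u, n, f, hf, hu⟩
  · intro u
    obtain ⟨n, hn⟩ := hM u
    obtain ⟨f, hf, hf'⟩ := exists_cocyc_zero (J := J) n hn
    obtain ⟨x, hx⟩ := hf.exists_lrel
    exact ⟨x, n, f, hx, hf'⟩
  · rintro u ⟨n, f, h1, h2⟩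
    obtain ⟨k, φ, hφ, g, hg⟩ := h1.zero
    have hd : dd J k 0 (0-1) = 0 := congrArg ModuleCat.Hom.hom
      ((Pr J k).complex.shape 0 (0-1) (by simp))
    rw [hd, LinearMap.comp_zero] at hg
    obtain ⟨p, hp⟩ := au_surj k (Submodule.Quotient.mk (1 : R) : R ⧸ J ^ k)
    have := LinearMap.congr_fun hg p
    change f (cm J φ 0 p) = 0 at this
    rw [h2 _ 1 (au_lift_mk hφ hp)] at this
    simpa using this
  · rintro x ⟨n, f, h1, h2⟩
    refine h1.cobd ⟨0, ?_⟩
    ext p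
    obtain ⟨r, hr⟩ := Submodule.Quotient.mk_surjective _ (au n p)
    simpa using h2 p r hr.symm

end Van
end LCAux

namespace LCAux
open CategoryTheory Limits Opposite

section QZ
variable {R : Type u} [CommRing R]
variable {M : Type u} [AddCommGroup M] [Module R M]
variable {N : Type u} [AddCommGroup N] [Module R N]

/-- `(y_1^n, ..., y_d^n) M`. -/
def Q {d : ℕ} (y : Fin d → R) (n : ℕ) (M : Type u) [AddCommGroup M] [Module R M] :
    Submodule R M := Ideal.span (Set.range (fun i => y i ^ n)) • ⊤

variable {d : ℕ} {y : Fin d → R} {n : ℕ}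

lemma Q_map (f : M →ₗ[R] N) {u : M} (hu : u ∈ Q y n M) : f u ∈ Q y n N := by
  have : Submodule.map f (Q y n M) ≤ Q y n N := by
    unfold Q
    rw [Submodule.map_smul'']
    exact Submodule.smul_mono le_rfl le_top
  exact this ⟨u, hu, rfl⟩

lemma Q_surj (f : M →ₗ[R] N) (hf : Function.Surjective f) {c : N} (hc : c ∈ Q y n N) :
    ∃ u ∈ Q y n M, f u = c := by
  have : Submodule.map f (Q y n M) = Q y n N := by
    unfold Q
    rw [Submodule.map_smul'', Submodule.map_top, LinearMap.range_eq_top.2 hf]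
  rw [← this] at hc
  exact hc

lemma Q_gen (i : Fin d) (v : M) : y i ^ n • v ∈ Q y n M :=
  Submodule.smul_mem_smul (Ideal.subset_span ⟨i, rfl⟩) trivial

lemma Q_le {S : Submodule R M} (h : ∀ i v, y i ^ n • v ∈ S) : Q y n M ≤ S := by
  unfold Q
  rw [Submodule.smul_le]
  intro r hr v _
  induction hr using Submodule.span_induction with
  | mem r hr => obtain ⟨i, rfl⟩ := hr; exact h i v
  | zero => simp
  | add a b _ _ ha hb => rw [add_smul]; exact S.add_mem ha hb
  | smul a b _ hb => rw [smul_eq_mul, mul_smul]; exact S.smul_mem _ hb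

lemma Q_mono {m : ℕ} (h : n ≤ m) : Q y m M ≤ Q y n M := by
  apply Q_le
  intro i v
  obtain ⟨k, rfl⟩ := Nat.exists_eq_add_of_le h
  rw [pow_add, mul_smul]
  exact Q_gen i _

lemma Q_prod (s : ℕ) {u : M} (hu : u ∈ Q y n M) : (∏ i, y i) ^ s • u ∈ Q y (n + s) M := by
  have : Q y n M ≤ (Q y (n + s) M).comap (LinearMap.lsmul R M ((∏ i, y i) ^ s)) := by
    apply Q_le
    intro i v
    change (∏ i, y i) ^ s • (y i ^ n • v) ∈ Q y (n + s) M
    rw [← Finset.mul_prod_erase _ _ (Finset.mem_univ i), smul_smul, mul_pow, mul_right_comm,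
      ← pow_add, add_comm s n, mul_smul]
    exact Q_gen i _
  exact this hu

lemma mem_Q_succ {x : Fin (d+1) → R} {u : M} : u ∈ Q x n M ↔
    ∃ v w, w ∈ Q (fun i : Fin d => x i.succ) n M ∧ u = x 0 ^ n • v + w := by
  constructor
  · intro h
    let S : Submodule R M := LinearMap.range (LinearMap.lsmul R M (x 0 ^ n)) ⊔
      Q (fun i : Fin d => x i.succ) n M
    have hS : Q x n M ≤ S := by
      apply Q_le
      intro i v
      refine Fin.cases ?_ (fun i => ?_) i
      · exact Submodule.mem_sup_left ⟨v, rfl⟩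
      · exact Submodule.mem_sup_right (Q_gen (y := fun i : Fin d => x i.succ) i v)
    obtain ⟨_, ⟨v, rfl⟩, w, hw, e⟩ := Submodule.mem_sup.1 (hS h)
    exact ⟨v, w, hw, e.symm⟩
  · rintro ⟨v, w, hw, rfl⟩
    refine Submodule.add_mem _ (Q_gen 0 v) ?_
    exact (Q_le (S := Q x n M) (y := fun i : Fin d => x i.succ) (fun i v => Q_gen i.succ v)) hw

lemma mem_Q_last {x : Fin (d+1) → R} {u : M} : u ∈ Q x n M ↔
    ∃ v w, w ∈ Q (fun i : Fin d => x i.castSucc) n M ∧ u = x (Fin.last d) ^ n • v + w := by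
  constructor
  · intro h
    let S : Submodule R M := LinearMap.range (LinearMap.lsmul R M (x (Fin.last d) ^ n)) ⊔
      Q (fun i : Fin d => x i.castSucc) n M
    have hS : Q x n M ≤ S := by
      apply Q_le
      intro i v
      refine Fin.lastCases ?_ (fun i => ?_) i
      · exact Submodule.mem_sup_left ⟨v, rfl⟩
      · exact Submodule.mem_sup_right (Q_gen (y := fun i : Fin d => x i.castSucc) i v)
    obtain ⟨_, ⟨v, rfl⟩, w, hw, e⟩ := Submodule.mem_sup.1 (hS h)
    exact ⟨v, w, hw, e.symm⟩
  · rintro ⟨v, w, hw, rfl⟩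
    refine Submodule.add_mem _ (Q_gen _ v) ?_
    exact (Q_le (S := Q x n M) (y := fun i : Fin d => x i.castSucc) (fun i v => Q_gen i.castSucc v)) hw

/-- `u` represents the zero class at level `n`. -/
def Z {d : ℕ} (y : Fin d → R) (n : ℕ) (u : M) : Prop := ∃ k, (∏ i, y i) ^ k • u ∈ Q y (n + k) M

/-- `L` is the limit of the `M / (x^n) M`. -/
structure LimPres {d : ℕ} (x : Fin d → R) (L : Type u) [AddCommGroup L] [Module R L]
    (π : ℕ → M →ₗ[R] L) : Prop where
  surj : ∀ l, ∃ n u, π n u = l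
  zero : ∀ n u, π n u = 0 ↔ Z x n u
  succ : ∀ n u, π (n+1) ((∏ i, x i) • u) = π n u

lemma LimPres.iter {x : Fin d → R} {L : Type u} [AddCommGroup L] [Module R L]
    {π : ℕ → M →ₗ[R] L} (h : LimPres x L π) (n k : ℕ) (u : M) :
    π (n + k) ((∏ i, x i) ^ k • u) = π n u := by
  induction k generalizing u with
  | zero => simp
  | succ k ih => rw [pow_succ', mul_smul, ← add_assoc, h.succ, ih]

/-- Elementwise description of the localization at the powers of `z`. -/
structure LocData (z : R) (ι : M →ₗ[R] N) : Prop where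
  bij : Function.Bijective (fun v : N => z • v)
  surj : ∀ v : N, ∃ k u, z ^ k • v = ι u
  ker : ∀ u : M, ι u = 0 → ∃ k, z ^ k • u = 0

lemma exists_locData (z : R) (M : Type u) [AddCommGroup M] [Module R M] :
    ∃ (N : Type u) (_ : AddCommGroup N) (_ : Module R N) (ι : M →ₗ[R] N), LocData z ι := by
  refine ⟨LocalizedModule (Submonoid.powers z) M, inferInstance, inferInstance,
    LocalizedModule.mkLinearMap _ _, ?_, ?_, ?_⟩
  · have := (Module.End.isUnit_iff _).1 (IsLocalizedModule.map_units (LocalizedModule.mkLinearMap (Submonoid.powers z) M)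
      ⟨z, Submonoid.mem_powers z⟩)
    exact this
  · intro v
    obtain ⟨⟨u, ⟨_, k, rfl⟩⟩, h⟩ := IsLocalizedModule.surj (Submonoid.powers z)
      (LocalizedModule.mkLinearMap (Submonoid.powers z) M) v
    exact ⟨k, u, h⟩
  · intro u hu
    obtain ⟨⟨_, k, rfl⟩, h⟩ := (IsLocalizedModule.eq_zero_iff (Submonoid.powers z)
      (LocalizedModule.mkLinearMap (Submonoid.powers z) M)).1 hu
    exact ⟨k, h⟩

section
variable {z : R} {ι : M →ₗ[R] N}

lemma LocData.inj (hι : LocData z ι) {a b : N} (k : ℕ) (h : z ^ k • a = z ^ k • b) : a = b := by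
  induction k with
  | zero => simpa using h
  | succ k ih =>
    rw [pow_succ', mul_smul, mul_smul] at h
    exact ih (hι.bij.1 h)

/-- Division by `z ^ n`. -/
lemma LocData.div (hι : LocData z ι) (n : ℕ) : ∃ e : N →ₗ[R] N, ∀ v, z ^ n • e v = v := by
  have hb : Function.Bijective (LinearMap.lsmul R N (z ^ n)) := by
    constructor
    · intro a b h
      exact hι.inj n h
    · intro v
      induction n generalizing v with
      | zero => exact ⟨v, by simp⟩
      | succ n ih =>
        obtain ⟨w, hw⟩ := hι.bij.2 v
        obtain ⟨w', hw'⟩ := ih w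
        refine ⟨w', ?_⟩
        change z ^ (n + 1) • w' = v
        change z ^ n • w' = w at hw'
        rw [pow_succ', mul_smul, hw', ← hw]
  refine ⟨(LinearEquiv.ofBijective _ hb).symm.toLinearMap, fun v => ?_⟩
  exact (LinearEquiv.ofBijective _ hb).apply_symm_apply v

lemma LocData.Q_clear (hι : LocData z ι) {q : N} (hq : q ∈ Q y n N) : ∃ j, ∃ q' ∈ Q y n M, z ^ j • q = ι q' := by
  unfold Q at hq
  refine Submodule.smul_induction_on hq ?_ ?_
  · intro r hr v _
    obtain ⟨k, u, h⟩ := hι.surj v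
    exact ⟨k, r • u, Submodule.smul_mem_smul hr trivial, by rw [smul_comm, h, map_smul]⟩
  · rintro a b ⟨j, q, hq, e⟩ ⟨j', q', hq', e'⟩
    refine ⟨j + j', z ^ j' • q + z ^ j • q', ?_, ?_⟩
    · exact Submodule.add_mem _ (Submodule.smul_mem _ _ hq) (Submodule.smul_mem _ _ hq')
    · rw [map_add, map_smul, map_smul, ← e, ← e', smul_smul, smul_smul, ← pow_add, ← pow_add,
        add_comm j' j, smul_add]
end

end QZ

section TB
variable {R : Type u} [CommRing R] {J : Ideal R}

/-- Torsion condition. -/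
def TC (J : Ideal R) {d : ℕ} (x : Fin d → R) (M : Type u) [AddCommGroup M] [Module R M] : Prop :=
  ∀ u : M, J ≤ (Ideal.span (Set.range x) ⊔ Ideal.torsionOf R M u).radical

variable {M : Type u} [AddCommGroup M] [Module R M]
variable {N : Type u} [AddCommGroup N] [Module R N] {d : ℕ}

lemma TC.tail {x : Fin (d+1) → R} (h : TC J x M)
    (hN : ∀ w : N, (∃ k, x 0 ^ k • w = 0) ∧ ∃ u : M, Ideal.torsionOf R M u ≤ Ideal.torsionOf R N w) :
    TC J (fun i : Fin d => x i.succ) N := by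
  intro w
  obtain ⟨⟨k, hk⟩, u, hu⟩ := hN w
  refine (h u).trans ?_
  have : Ideal.span (Set.range x) ⊔ Ideal.torsionOf R M u ≤
      (Ideal.span (Set.range fun i : Fin d => x i.succ) ⊔ Ideal.torsionOf R N w).radical := by
    refine sup_le ?_ ((hu.trans le_sup_right).trans Ideal.le_radical)
    rw [Ideal.span_le]
    rintro _ ⟨i, rfl⟩
    refine Fin.cases ?_ (fun i => ?_) i
    · exact ⟨k, Ideal.mem_sup_right (by rw [Ideal.mem_torsionOf_iff]; exact hk)⟩
    · exact Ideal.le_radical (Ideal.mem_sup_left (Ideal.subset_span ⟨i, rfl⟩))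
  exact (Ideal.radical_mono this).trans (Ideal.radical_idem _).le

lemma TC.tors [IsNoetherianRing R] {x : Fin 0 → R} (h : TC J x M) : Tors J M := by
  intro u
  have h1 := h u
  rw [Set.range_eq_empty, Ideal.span_empty, bot_sup_eq] at h1
  obtain ⟨n, hn⟩ := Ideal.exists_pow_le_of_le_radical_of_fg h1 (IsNoetherian.noetherian _)
  exact ⟨n, fun r hr => (Ideal.mem_torsionOf_iff _ _).1 (hn hr)⟩

lemma tc_ker {x : Fin (d+1) → R} (h : TC J x M) {ι : M →ₗ[R] N} (hι : LocData (x 0) ι) :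
    TC J (fun i : Fin d => x i.succ) (LinearMap.ker ι) := by
  refine h.tail fun w => ⟨?_, w.1, ?_⟩
  · obtain ⟨k, hk⟩ := hι.ker w.1 w.2
    exact ⟨k, Subtype.ext hk⟩
  · intro r hr
    rw [Ideal.mem_torsionOf_iff] at *
    exact Subtype.ext hr

lemma tc_coker {x : Fin (d+1) → R} (h : TC J x M) {ι : M →ₗ[R] N} (hι : LocData (x 0) ι) :
    TC J (fun i : Fin d => x i.succ) (N ⧸ LinearMap.range ι) := by
  refine h.tail fun w => ?_
  obtain ⟨v, rfl⟩ := Submodule.mkQ_surjective _ w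
  obtain ⟨k, u, hu⟩ := hι.surj v
  refine ⟨⟨k, ?_⟩, u, ?_⟩
  · rw [← map_smul, hu]
    exact (Submodule.Quotient.mk_eq_zero _).2 ⟨u, rfl⟩
  · intro r hr
    rw [Ideal.mem_torsionOf_iff] at *
    rw [← map_smul]
    have : r • v = 0 := by
      apply hι.inj k
      rw [smul_comm, hu, ← map_smul, hr, map_zero, smul_zero]
    rw [this, map_zero]

lemma van_tc [IsNoetherianRing R] (d : ℕ) : ∀ (M : Type u) [AddCommGroup M] [Module R M]
    (x : Fin d → R), (∀ i, x i ∈ J) → TC J x M → ∀ i, d < i → Van J i M := by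
  induction d with
  | zero =>
    intro M _ _ x hx h i hi
    obtain ⟨i, rfl⟩ : ∃ j, i = j + 1 := ⟨i - 1, by omega⟩
    exact van_tors i M h.tors
  | succ d ih =>
    intro M _ _ x hx h i hi
    obtain ⟨N, _, _, ι, hι⟩ := exists_locData (x 0) M
    have h1 := ih _ _ (fun i => hx i.succ) (tc_ker h hι)
    have h2 := ih _ _ (fun i => hx i.succ) (tc_coker h hι)
    obtain ⟨i, rfl⟩ : ∃ j, i = j + 1 := ⟨i - 1, by omega⟩
    have h3 : Van J (i+1) (LinearMap.range ι) :=
      Van.shift (α := (LinearMap.range ι).subtype) (β := (LinearMap.range ι).mkQ)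
        (Submodule.subtype_injective _) (Submodule.mkQ_surjective _)
        (LinearMap.exact_subtype_mkQ _) (h2 i (by omega)) (van_bij (hx 0) hι.bij _)
    refine Van.middle (α := (LinearMap.ker ι).subtype) (β := ι.rangeRestrict)
        (Submodule.subtype_injective _) ι.surjective_rangeRestrict ?_ (h1 _ (by omega)) h3
    rw [LinearMap.exact_iff, LinearMap.ker_rangeRestrict, Submodule.range_subtype]

lemma limPres_step {x : Fin (d+1) → R} {ι : M →ₗ[R] N} (hι : LocData (x 0) ι)
    {L L' : Type u} [AddCommGroup L] [Module R L] [AddCommGroup L'] [Module R L']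
    {π : ℕ → (N ⧸ LinearMap.range ι) →ₗ[R] L} (h : LimPres (fun i : Fin d => x i.succ) L π)
    (E : L ≃ₗ[R] L') : ∃ π' : ℕ → M →ₗ[R] L', LimPres x L' π' := by
  choose e he using hι.div
  have hP : ∏ i, x i = x 0 * ∏ i : Fin d, x i.succ := Fin.prod_univ_succ x
  set P := ∏ i : Fin d, x i.succ
  refine ⟨fun n => E.toLinearMap ∘ₗ π n ∘ₗ Submodule.mkQ _ ∘ₗ e n ∘ₗ ι, ?_, ?_, ?_⟩
  · intro l
    obtain ⟨n, c, hc⟩ := h.surj (E.symm l)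
    obtain ⟨w, rfl⟩ := Submodule.mkQ_surjective _ c
    obtain ⟨k, u, hu⟩ := hι.surj w
    refine ⟨n + k, P ^ k • x 0 ^ n • u, ?_⟩
    have : e (n + k) (ι (P ^ k • x 0 ^ n • u)) = P ^ k • w := by
      apply hι.inj (n + k)
      rw [he, map_smul, map_smul, ← hu, smul_smul (x 0 ^ n), ← pow_add, smul_comm]
    change E (π _ (Submodule.mkQ _ (e (n+k) (ι _)))) = l
    rw [this, map_smul, h.iter, hc, LinearEquiv.apply_symm_apply]
  · intro n u
    change E (π _ (Submodule.mkQ _ (e n (ι u)))) = 0 ↔ _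
    rw [LinearEquiv.map_eq_zero_iff, h.zero]
    constructor
    · rintro ⟨k, hk⟩
      obtain ⟨q, hq, e1⟩ := Q_surj _ (Submodule.mkQ_surjective (LinearMap.range ι)) hk
      rw [← map_smul, ← sub_eq_zero, ← map_sub] at e1
      obtain ⟨w, hw⟩ := (Submodule.Quotient.mk_eq_zero _).1 e1
      obtain ⟨j, q', hq', e2⟩ := hι.Q_clear hq
      have hn := he n (ι u)
      have e3 : ι (x 0 ^ j • P ^ k • u + x 0 ^ (n + j) • w - x 0 ^ n • q') = 0 := by
        simp only [map_sub, map_add, map_smul]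
        linear_combination (norm := module) -(x 0 ^ j * P ^ k) • hn + x 0 ^ (n + j) • hw + x 0 ^ n • e2
      obtain ⟨l, hl⟩ := hι.ker _ e3
      refine ⟨j + l + k, mem_Q_succ.2 ⟨-(P ^ (j + l) • w),
        x 0 ^ (k + l + n) • P ^ (j + l) • q', ?_, ?_⟩⟩
      · have := Q_prod (j + l) hq'
        rw [show n + (j + l + k) = n + k + (j + l) by omega]
        exact Submodule.smul_mem _ _ this
      · rw [hP]
        linear_combination (norm := module) (x 0 ^ k * P ^ (j + l)) • hl
    · rintro ⟨k, hk⟩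
      refine ⟨k, ?_⟩
      obtain ⟨v, w, hw, e1⟩ := mem_Q_succ.1 hk
      have e2 : P ^ k • e n (ι u) = ι v + e (n + k) (ι w) := by
        apply hι.inj (n + k)
        have e1' := congrArg ι e1
        simp only [map_add, map_smul] at e1'
        rw [hP] at e1'
        linear_combination (norm := module) (x 0 ^ k * P ^ k) • he n (ι u) + e1' - he (n + k) (ι w)
      rw [← map_smul, e2, map_add, show Submodule.mkQ (LinearMap.range ι) (ι v) = 0 from
        (Submodule.Quotient.mk_eq_zero _).2 ⟨v, rfl⟩, zero_add]
      exact Q_map _ (Q_map _ (Q_map _ hw))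
  · intro n u
    change E (π _ (Submodule.mkQ _ (e (n+1) (ι _)))) = E (π _ (Submodule.mkQ _ (e n (ι _))))
    have : e (n + 1) (ι ((∏ i, x i) • u)) = P • e n (ι u) := by
      apply hι.inj (n + 1)
      rw [he, hP, map_smul]
      linear_combination (norm := module) -(x 0 * P) • he n (ι u)
    rw [this, map_smul, h.succ]

theorem limPres_LC [IsNoetherianRing R] (d : ℕ) : ∀ (M : Type u) [AddCommGroup M] [Module R M]
    (x : Fin d → R), (∀ i, x i ∈ J) → TC J x M →
      ∃ π : ℕ → M →ₗ[R] LC J M d, LimPres x (LC J M d) π := by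
  induction d with
  | zero =>
    intro M _ _ x hx h
    obtain ⟨e⟩ := iso_zero h.tors
    have hQ : ∀ n, Q x n M = ⊥ := by
      intro n
      rw [eq_bot_iff]
      exact Q_le (fun i => i.elim0)
    refine ⟨fun _ => e.symm.toLinearMap, fun l => ⟨0, e l, by simp⟩, fun n u => ?_, fun n u => ?_⟩
    · simp [Z, hQ]
    · simp
  | succ d ih =>
    intro M _ _ x hx h
    obtain ⟨N, _, _, ι, hι⟩ := exists_locData (x 0) M
    obtain ⟨π, hπ⟩ := ih _ _ (fun i => hx i.succ) (tc_coker h hι)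
    have hv := van_tc (J := J) d _ _ (fun i => hx i.succ) (tc_ker h hι)
    obtain ⟨e1⟩ := iso_quot (J := J) (i := d + 1) (α := (LinearMap.ker ι).subtype) (β := ι.rangeRestrict)
      (Submodule.subtype_injective _) ι.surjective_rangeRestrict
      (by rw [LinearMap.exact_iff, LinearMap.ker_rangeRestrict, Submodule.range_subtype])
      (hv (d+1) (by omega)) (hv (d+2) (by omega))
    obtain ⟨e2⟩ := iso_shift (J := J) (i := d) (α := (LinearMap.range ι).subtype)
      (β := (LinearMap.range ι).mkQ)
      (Submodule.subtype_injective _) (Submodule.mkQ_surjective _)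
      (LinearMap.exact_subtype_mkQ _) (van_bij (hx 0) hι.bij _) (van_bij (hx 0) hι.bij _)
    exact limPres_step hι hπ (e2.trans e1.symm)

end TB
end LCAux

namespace LCAux
open Paper

section SOP
variable {R : Type u} [CommRing R] [IsLocalRing R] [IsNoetherianRing R]
variable {M : Type u} [AddCommGroup M] [Module R M]
variable {N : Type u} [AddCommGroup N] [Module R N] {d : ℕ}

lemma fl_of_pow (W : Type u) [AddCommGroup W] [Module R W] [Module.Finite R W] {n : ℕ}
    (h : maximalIdeal R ^ n • (⊤ : Submodule R W) = ⊥) : IsFiniteLength R W := by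
  have h' : maximalIdeal R ^ (n + 1) • (⊤ : Submodule R W) = ⊥ := by
    rw [eq_bot_iff, ← h]
    exact Submodule.smul_mono (Ideal.pow_le_pow_right (by omega)) le_rfl
  set I := maximalIdeal R ^ (n + 1) with hI
  have hne : I ≠ ⊤ := by
    intro h0
    have : I ≤ maximalIdeal R := Ideal.pow_le_self (by omega)
    rw [h0] at this
    exact (Ideal.IsMaximal.ne_top inferInstance) (top_le_iff.1 this)
  have hT : Module.IsTorsionBySet R W (I : Set R) := by
    rintro u ⟨r, hr⟩
    have : r • u ∈ I • (⊤ : Submodule R W) := Submodule.smul_mem_smul hr trivial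
    rw [h'] at this
    exact this
  let _ := hT.module
  have : Nontrivial (R ⧸ I) := Ideal.Quotient.nontrivial_iff.2 hne
  have : IsLocalRing (R ⧸ I) := IsLocalRing.of_surjective' (Ideal.Quotient.mk I)
    Ideal.Quotient.mk_surjective
  have hart : IsArtinianRing (R ⧸ I) := by
    rw [isArtinianRing_iff_isNilpotent_maximalIdeal]
    refine ⟨n + 1, ?_⟩
    rw [← IsLocalRing.map_maximalIdeal_of_surjective (Ideal.Quotient.mk I)
      Ideal.Quotient.mk_surjective, ← Ideal.map_pow]
    exact Ideal.map_quotient_self I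
  have : Module.Finite (R ⧸ I) W := Module.Finite.of_restrictScalars_finite R _ _
  have hW : IsArtinian (R ⧸ I) W := inferInstance
  rw [isFiniteLength_iff_isNoetherian_isArtinian]
  exact ⟨inferInstance, (hT.semilinearMap.isArtinian_iff_of_bijective Function.bijective_id).2 hW⟩

lemma pow_of_fl (W : Type u) [AddCommGroup W] [Module R W]
    (h : IsFiniteLength R W) : ∃ n, maximalIdeal R ^ n • (⊤ : Submodule R W) = ⊥ := by
  obtain ⟨_, _⟩ := isFiniteLength_iff_isNoetherian_isArtinian.1 h
  obtain ⟨n, hn⟩ := IsArtinian.monotone_stabilizes (R := R) (M := W)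
    ⟨fun n => OrderDual.toDual (maximalIdeal R ^ n • (⊤ : Submodule R W)), fun a b hab =>
      Submodule.smul_mono (Ideal.pow_le_pow_right hab) le_rfl⟩
  refine ⟨n, ?_⟩
  apply Submodule.eq_bot_of_le_smul_of_le_jacobson_bot (maximalIdeal R) _ (IsNoetherian.noetherian _)
  · have := hn (n + 1) (by omega)
    change maximalIdeal R ^ n • (⊤ : Submodule R W) = maximalIdeal R ^ (n+1) • ⊤ at this
    conv_lhs => rw [this]
    rw [pow_succ', Submodule.mul_smul]
  · exact IsLocalRing.maximalIdeal_le_jacobson _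

lemma mem_smul_top_iff {g : M →ₗ[R] N} (hg : Function.Surjective g) (I : Ideal R) (u : M) :
    g u ∈ (I • ⊤ : Submodule R N) ↔ u ∈ (I • ⊤ : Submodule R M) ⊔ LinearMap.ker g := by
  rw [← Submodule.comap_map_eq, Submodule.mem_comap, Submodule.map_smul'', Submodule.map_top,
    LinearMap.range_eq_top.2 hg]

lemma sop_iff [Module.Finite R M] {x : Fin d → R} : IsSOP R M d x ↔
    (∀ i, x i ∈ maximalIdeal R) ∧
      ∃ n, maximalIdeal R ^ n • ⊤ ≤ (Ideal.span (Set.range x) • ⊤ : Submodule R M) := by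
  unfold IsSOP
  refine and_congr_right fun _ => ?_
  set K := (Ideal.span (Set.range x) • ⊤ : Submodule R M)
  have key : ∀ n, maximalIdeal R ^ n • (⊤ : Submodule R (M ⧸ K)) = ⊥ ↔
      maximalIdeal R ^ n • ⊤ ≤ K := by
    intro n
    rw [← LinearMap.range_eq_top.2 (Submodule.mkQ_surjective K), ← Submodule.map_top,
      ← Submodule.map_smul'', ← le_bot_iff, Submodule.map_le_iff_le_comap, Submodule.comap_bot,
      Submodule.ker_mkQ]
  constructor
  · intro h
    obtain ⟨n, hn⟩ := pow_of_fl _ h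
    exact ⟨n, (key n).1 hn⟩
  · rintro ⟨n, hn⟩
    exact fl_of_pow _ ((key n).2 hn)

lemma pow_smul_le {I q : Ideal R} (h : I • ⊤ ≤ (q • ⊤ : Submodule R M)) (k : ℕ) :
    I ^ k • ⊤ ≤ (q ^ k • ⊤ : Submodule R M) := by
  induction k with
  | zero => simp
  | succ k ih =>
    rw [pow_succ, Submodule.mul_smul, pow_succ', Submodule.mul_smul]
    refine (Submodule.smul_mono le_rfl h).trans ?_
    rw [← Submodule.mul_smul, mul_comm, Submodule.mul_smul]
    exact Submodule.smul_mono le_rfl ih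

lemma sop_pow [Module.Finite R M] {x : Fin d → R} (h : IsSOP R M d x) {a : Fin d → ℕ}
    (ha : ∀ i, a i ≠ 0) : IsSOP R M d (fun i => x i ^ a i) := by
  rw [sop_iff] at *
  obtain ⟨hx, n, hn⟩ := h
  refine ⟨fun i => Ideal.pow_mem_of_mem _ (hx i) _ (Nat.pos_of_ne_zero (ha i)), ?_⟩
  have : Ideal.span (Set.range x) ≤ (Ideal.span (Set.range fun i => x i ^ a i)).radical := by
    rw [Ideal.span_le]
    rintro _ ⟨i, rfl⟩
    exact ⟨a i, Ideal.subset_span ⟨i, rfl⟩⟩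
  obtain ⟨k, hk⟩ := Ideal.exists_pow_le_of_le_radical_of_fg this (IsNoetherian.noetherian _)
  refine ⟨n * k, ?_⟩
  rw [pow_mul]
  exact (pow_smul_le hn k).trans (Submodule.smul_mono hk le_rfl)

lemma sop_map [Module.Finite R M] {g : M →ₗ[R] N} (hg : Function.Surjective g) {x : Fin d → R}
    (h : IsSOP R M d x) : IsSOP R N d x := by
  have : Module.Finite R N := Module.Finite.of_surjective g hg
  rw [sop_iff] at *
  obtain ⟨hx, n, hn⟩ := h
  refine ⟨hx, n, ?_⟩
  have := Submodule.map_mono (f := g) hn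
  rwa [Submodule.map_smul'', Submodule.map_smul'', Submodule.map_top,
    LinearMap.range_eq_top.2 hg] at this

lemma mem_bIdeal {c : R} : c ∈ bIdeal R M d ↔ ∀ x : Fin d → R, IsSOP R M d x → ∀ (i : Fin d) (u : M),
    x i • u ∈ (Ideal.span (x '' {j | j < i}) • ⊤ : Submodule R M) →
    c • u ∈ (Ideal.span (x '' {j | j < i}) • ⊤ : Submodule R M) := by
  unfold bIdeal
  simp only [Submodule.mem_iInf]
  refine forall_congr' fun x => forall_congr' fun hx => forall_congr' fun i => ?_
  rw [Module.mem_annihilator]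
  constructor
  · intro h u hu
    have h1 := h ⟨Submodule.Quotient.mk u, by
      rw [Submodule.mem_torsionBy_iff, ← Submodule.Quotient.mk_smul]
      exact (Submodule.Quotient.mk_eq_zero _).2 hu⟩
    have h2 := congrArg Subtype.val h1
    exact (Submodule.Quotient.mk_eq_zero _).1 h2
  · rintro h ⟨w, hw⟩
    obtain ⟨u, rfl⟩ := Submodule.Quotient.mk_surjective _ w
    apply Subtype.ext
    rw [Submodule.mem_torsionBy_iff, ← Submodule.Quotient.mk_smul] at hw
    exact (Submodule.Quotient.mk_eq_zero _).2 (h u ((Submodule.Quotient.mk_eq_zero _).1 hw))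

lemma bIdeal_equiv_le [Module.Finite R M] (e : M ≃ₗ[R] N) : bIdeal R M d ≤ bIdeal R N d := by
  have : Module.Finite R N := Module.Finite.equiv e
  intro c hc
  rw [mem_bIdeal] at *
  intro x hx i u hu
  have h := hc x (sop_map e.symm.surjective hx) i (e.symm u) (by
    rw [← map_smul]
    have := (mem_smul_top_iff (g := e.toLinearMap) e.surjective _ (e.symm (x i • u))).1
      (by simpa using hu)
    simpa [LinearEquiv.ker] using this)
  have := (mem_smul_top_iff (g := e.toLinearMap) e.surjective _ _).2 (Submodule.mem_sup_left h)
  simpa using this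

/-- Cutting by a first parameter. -/
lemma bIdeal_cut [Module.Finite R M] {g : M →ₗ[R] N} (hg : Function.Surjective g) {z : R}
    (hz : z ∈ maximalIdeal R) (hk : LinearMap.ker g = Ideal.span {z} • ⊤) :
    bIdeal R M (d+1) ≤ bIdeal R N d := by
  have : Module.Finite R N := Module.Finite.of_surjective g hg
  intro c hc
  rw [mem_bIdeal] at *
  intro y hy i u hu
  obtain ⟨u, rfl⟩ := hg u
  have hs : IsSOP R M (d+1) (Fin.cons z y) := by
    rw [sop_iff] at *
    obtain ⟨h1, n, hn⟩ := hy
    refine ⟨fun i => ?_, n, ?_⟩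
    · refine Fin.cases ?_ (fun i => ?_) i
      · simpa using hz
      · simpa using h1 i
    · intro v hv
      have h3 : g v ∈ (Ideal.span (Set.range y) • ⊤ : Submodule R N) :=
        hn ((mem_smul_top_iff hg _ v).2 (Submodule.mem_sup_left hv))
      rw [mem_smul_top_iff hg, hk, ← Submodule.sup_smul, ← Ideal.span_union] at h3
      rw [Fin.range_cons, Set.insert_eq, Set.union_comm]
      exact h3
  have himg : (Fin.cons z y : Fin (d+1) → R) '' {j | j < i.succ} = (y '' {j | j < i}) ∪ {z} := by
    ext r
    constructor
    · rintro ⟨j, hj, rfl⟩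
      revert hj
      refine Fin.cases ?_ (fun j => ?_) j
      · intro _; right; simp
      · intro hj
        left
        exact ⟨j, by simpa using hj, by simp⟩
    · rintro (⟨j, hj, rfl⟩ | rfl)
      · exact ⟨j.succ, by simpa using hj, by simp⟩
      · exact ⟨0, by simp, by simp⟩
  have key : ∀ v, v ∈ (Ideal.span ((Fin.cons z y : Fin (d+1) → R) '' {j | j < i.succ}) • ⊤ :
      Submodule R M) ↔ g v ∈ (Ideal.span (y '' {j | j < i}) • ⊤ : Submodule R N) := by
    intro v
    rw [himg, mem_smul_top_iff hg, hk, ← Submodule.sup_smul, ← Ideal.span_union]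
  rw [← map_smul, ← key]
  apply hc _ hs i.succ u
  rw [key, Fin.cons_succ, map_smul]
  exact hu

/-- A version of `C`-system of parameters in terms of arbitrary quotients. -/
def CS {d : ℕ} (x : Fin d → R) (M : Type u) [AddCommGroup M] [Module R M] : Prop :=
  IsSOP R M d x ∧ ∀ (i : Fin d) (N : Type u) [AddCommGroup N] [Module R N] (f : M →ₗ[R] N),
    Function.Surjective f → LinearMap.ker f = Ideal.span (x '' {j | i < j}) • ⊤ →
    x i ∈ (bIdeal R N ((i : ℕ) + 1)) ^ 3

lemma cs_of_csop [Module.Finite R M] {x : Fin d → R} (h : IsCSOP R M d x) : CS x M := by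
  refine ⟨h.1, fun i N _ _ f hf hk => ?_⟩
  refine Ideal.pow_right_mono (bIdeal_equiv_le ?_) 3 (h.2 i)
  exact (Submodule.quotEquivOfEq _ _ hk.symm).trans (f.quotKerEquivOfSurjective hf)

lemma CS.last {x : Fin (d+1) → R} (h : CS x M) : x (Fin.last d) ∈ bIdeal R M (d+1) ^ 3 := by
  refine h.2 (Fin.last d) M LinearMap.id Function.surjective_id ?_
  have : {j | Fin.last d < j} = ∅ := by
    ext j
    simpa using Fin.le_last j
  rw [this]
  simp

lemma CS.init [Module.Finite R M] {x : Fin (d+1) → R} (h : CS x M) {g : M →ₗ[R] N}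
    (hg : Function.Surjective g) (hk : LinearMap.ker g = Ideal.span {x (Fin.last d)} • ⊤) :
    CS (fun i : Fin d => x i.castSucc) N := by
  have : Module.Finite R N := Module.Finite.of_surjective g hg
  refine ⟨?_, fun i E _ _ f hf hkf => ?_⟩
  · have h0 := h.1
    rw [sop_iff] at *
    obtain ⟨hx, n, hn⟩ := h0
    refine ⟨fun i => hx _, n, ?_⟩
    intro v hv
    obtain ⟨v, rfl⟩ := hg v
    rw [mem_smul_top_iff hg, hk, ← Submodule.sup_smul, ← Ideal.span_union]
    rw [mem_smul_top_iff hg] at hv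
    obtain ⟨a, ha, b, hb, rfl⟩ := Submodule.mem_sup.1 hv
    refine Submodule.add_mem _ ?_ ?_
    · refine Submodule.smul_mono (Ideal.span_mono ?_) le_rfl (hn ha)
      rintro _ ⟨i, rfl⟩
      refine Fin.lastCases ?_ (fun i => ?_) i
      · right; rfl
      · left; exact ⟨i, rfl⟩
    · rw [hk] at hb
      exact Submodule.smul_mono (Ideal.span_mono (Set.subset_union_right)) le_rfl hb
  · refine h.2 i.castSucc E (f ∘ₗ g) (hf.comp hg) ?_
    have himg : x '' {j | i.castSucc < j} =
        ((fun i : Fin d => x i.castSucc) '' {j | i < j}) ∪ {x (Fin.last d)} := by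
      ext r
      constructor
      · rintro ⟨j, hj, rfl⟩
        revert hj
        refine Fin.lastCases ?_ (fun j => ?_) j
        · intro _; right; simp
        · intro hj
          left
          exact ⟨j, by simpa using hj, by simp⟩
      · rintro (⟨j, hj, rfl⟩ | rfl)
        · exact ⟨j.castSucc, by simpa using hj, by simp⟩
        · exact ⟨Fin.last d, by simpa using i.castSucc_lt_last, by simp⟩
    ext v
    rw [himg, LinearMap.mem_ker, LinearMap.comp_apply, ← LinearMap.mem_ker, hkf,
      mem_smul_top_iff hg, hk, ← Submodule.sup_smul, ← Ideal.span_union]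

lemma CS.tail [Module.Finite R M] {x : Fin (d+1) → R} (h : CS x M) {g : M →ₗ[R] N}
    (hg : Function.Surjective g) (hk : LinearMap.ker g = Ideal.span {x 0} • ⊤) :
    CS (fun i : Fin d => x i.succ) N := by
  have : Module.Finite R N := Module.Finite.of_surjective g hg
  refine ⟨?_, fun i E _ _ f hf hkf => ?_⟩
  · have h0 := h.1
    rw [sop_iff] at *
    obtain ⟨hx, n, hn⟩ := h0
    refine ⟨fun i => hx _, n, ?_⟩
    intro v hv
    obtain ⟨v, rfl⟩ := hg v
    rw [mem_smul_top_iff hg, hk, ← Submodule.sup_smul, ← Ideal.span_union]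
    rw [mem_smul_top_iff hg] at hv
    obtain ⟨a, ha, b, hb, rfl⟩ := Submodule.mem_sup.1 hv
    refine Submodule.add_mem _ ?_ ?_
    · refine Submodule.smul_mono (Ideal.span_mono ?_) le_rfl (hn ha)
      rintro _ ⟨i, rfl⟩
      refine Fin.cases ?_ (fun i => ?_) i
      · right; rfl
      · left; exact ⟨i, rfl⟩
    · rw [hk] at hb
      exact Submodule.smul_mono (Ideal.span_mono (Set.subset_union_right)) le_rfl hb
  · have himg : x '' {j | i.succ < j} = (fun i : Fin d => x i.succ) '' {j | i < j} := by
      ext r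
      constructor
      · rintro ⟨j, hj, rfl⟩
        revert hj
        refine Fin.cases ?_ (fun j => ?_) j
        · intro h; simp at h
        · intro hj
          exact ⟨j, by simpa using hj, by simp⟩
      · rintro ⟨j, hj, rfl⟩
        exact ⟨j.succ, by simpa using hj, by simp⟩
    set K : Submodule R M := Ideal.span (x '' {j | i.succ < j}) • ⊤ with hK
    have h1 := h.2 i.succ (M ⧸ K) K.mkQ (Submodule.mkQ_surjective K) (Submodule.ker_mkQ K)
    have hker : LinearMap.ker (f ∘ₗ g) = K ⊔ Ideal.span {x 0} • ⊤ := by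
      ext v
      rw [LinearMap.mem_ker, LinearMap.comp_apply, ← LinearMap.mem_ker, hkf,
        mem_smul_top_iff hg, hk, hK, himg]
    have hle : K ≤ LinearMap.ker (f ∘ₗ g) := hker ▸ le_sup_left
    refine Ideal.pow_right_mono (bIdeal_cut (g := K.liftQ (f ∘ₗ g) hle) ?_ (h.1.1 0) ?_) 3 h1
    · intro e
      obtain ⟨v, rfl⟩ := (hf.comp hg) e
      exact ⟨K.mkQ v, rfl⟩
    · have h0 : Submodule.map K.mkQ K = ⊥ := by
        rw [eq_bot_iff, Submodule.map_le_iff_le_comap, Submodule.comap_bot, Submodule.ker_mkQ]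
      rw [Submodule.ker_liftQ, hker, Submodule.map_sup, h0, bot_sup_eq, Submodule.map_smul'',
        Submodule.map_top, LinearMap.range_eq_top.2 (Submodule.mkQ_surjective K)]

end SOP
end LCAux

namespace LCAux
open Paper

section ThmA
variable {R : Type u} [CommRing R] [IsLocalRing R] [IsNoetherianRing R]

lemma tc_of_sop {M : Type u} [AddCommGroup M] [Module R M] [Module.Finite R M] {d : ℕ}
    {x : Fin d → R} (h : IsSOP R M d x) : TC (maximalIdeal R) x M := by
  obtain ⟨n, hn⟩ := (sop_iff.1 h).2
  intro u
  rw [Ideal.radical_eq_sInf]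
  refine le_sInf ?_
  rintro P ⟨hP, hPp⟩
  have hq : Ideal.span (Set.range x) ≤ P := le_sup_left.trans hP
  have hA : Module.annihilator R M ≤ P := by
    refine le_trans ?_ (le_sup_right.trans hP)
    intro r hr
    rw [Ideal.mem_torsionOf_iff]
    exact Module.mem_annihilator.1 hr u
  have hs : (⟨P, hPp⟩ : PrimeSpectrum R) ∈ Module.support R
      (M ⧸ (Ideal.span (Set.range x) • ⊤ : Submodule R M)) := by
    rw [Module.support_quotient]
    refine ⟨?_, hq⟩
    rw [Module.support_eq_zeroLocus]
    exact hA
  rw [Module.support_eq_zeroLocus] at hs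
  have hs' : Module.annihilator R (M ⧸ (Ideal.span (Set.range x) • ⊤ : Submodule R M)) ≤ P := hs
  have hm : maximalIdeal R ^ n ≤ P := by
    refine le_trans ?_ hs'
    intro r hr
    rw [Module.mem_annihilator]
    intro w
    obtain ⟨w, rfl⟩ := Submodule.Quotient.mk_surjective _ w
    rw [← Submodule.Quotient.mk_smul]
    exact (Submodule.Quotient.mk_eq_zero _).2 (hn (Submodule.smul_mem_smul hr trivial))
  exact hPp.le_of_pow_le hm

variable {M : Type u} [AddCommGroup M] [Module R M] {L : Type u} [AddCommGroup L] [Module R L]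
  {d : ℕ} {x : Fin (d+1) → R} {π : ℕ → M →ₗ[R] L}

lemma Q_init_le (n : ℕ) : Q (fun i : Fin d => x i.castSucc) n M ≤ Q x n M := by
  intro w hw
  rw [mem_Q_last]
  exact ⟨0, w, hw, by simp⟩

lemma LimPres.colon (h : LimPres x L π) {n j : ℕ} {a : M}
    (ha : x (Fin.last d) ^ j • a ∈ Q (fun i : Fin d => x i.castSucc) n M) : π n a = 0 := by
  rw [h.zero]
  refine ⟨j, ?_⟩
  have := Q_init_le (x := x) (n + j) (Q_prod j ha)
  rwa [smul_smul, ← mul_pow, ← Fin.prod_univ_castSucc] at this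

lemma b_colon [Module.Finite R M] (h : IsSOP R M (d+1) x) {c : R} (hc : c ∈ bIdeal R M (d+1))
    {e j : ℕ} {a : M}
    (ha : x (Fin.last d) ^ j • a ∈ Q (fun i : Fin d => x i.castSucc) (e+1) M) :
    c • a ∈ Q (fun i : Fin d => x i.castSucc) (e+1) M := by
  have hapow : x (Fin.last d) ^ (j+1) • a ∈ Q (fun i : Fin d => x i.castSucc) (e+1) M := by
    rw [pow_succ', mul_smul]
    exact Submodule.smul_mem _ _ ha
  have hs := sop_pow h (a := fun i => if i = Fin.last d then j+1 else e+1)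
    (fun i => by split_ifs <;> omega)
  have himg : (fun i => x i ^ (if i = Fin.last d then j+1 else e+1)) '' {i | i < Fin.last d} =
      Set.range (fun i : Fin d => x i.castSucc ^ (e+1)) := by
    ext r
    constructor
    · rintro ⟨i, hi, rfl⟩
      revert hi
      refine Fin.lastCases ?_ (fun i => ?_) i
      · intro hi; simp at hi
      · intro _
        exact ⟨i, by simp [(Fin.castSucc_lt_last i).ne]⟩
    · rintro ⟨i, rfl⟩
      exact ⟨i.castSucc, Fin.castSucc_lt_last i, by simp [(Fin.castSucc_lt_last i).ne]⟩
  have := mem_bIdeal.1 hc _ hs (Fin.last d) a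
  rw [himg] at this
  exact this (by simpa [Q] using hapow)

/-- First reduction: the class is `[z^e u]`. -/
lemma step1 (h : LimPres x L π) {s : L}
    (hz : x (Fin.last d) • s = 0) (hs : ∀ r ∈ maximalIdeal R, r • s = 0) :
    ∃ (e : ℕ) (u : M), π (e+1) (x (Fin.last d) ^ e • u) = s ∧
      ∀ r ∈ maximalIdeal R, ∃ p : M, x (Fin.last d) ^ e • (r • u - x (Fin.last d) • p) ∈
        Q (fun i : Fin d => x i.castSucc) (e+1) M := by
  obtain ⟨n, u, rfl⟩ := h.surj s
  set z := x (Fin.last d) with hzdef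
  set y : Fin d → R := fun i => x i.castSucc with hy
  have hprod : ∏ i, x i = (∏ i, y i) * z := Fin.prod_univ_castSucc x
  -- write the class as `[z^N v]_(N+1)`
  obtain ⟨N, v, hv⟩ : ∃ (N : ℕ) (v : M), π (N+1) (z ^ N • v) = π n u := by
    rw [← map_smul, h.zero] at hz
    obtain ⟨k, hk⟩ := hz
    have hk' : (∏ i, x i) ^ (k+1) • z • u ∈ Q x (n + k + 1) M := by
      rw [pow_succ', mul_smul]
      simpa using Q_prod 1 hk
    obtain ⟨v, w, hw, hvw⟩ := mem_Q_last.1 hk'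
    refine ⟨n + k, v, ?_⟩
    rw [← h.iter n (k+1) u, ← sub_eq_zero, ← add_assoc, ← map_sub]
    refine h.colon (j := 1) ?_
    have : x (Fin.last d) ^ 1 • (z ^ (n+k) • v - (∏ i, x i)^(k+1) • u) = -w := by
      rw [← hzdef] at hvw ⊢
      linear_combination (norm := module) - hvw
    rw [this]
    exact Submodule.neg_mem _ hw
  rw [← hv] at hs ⊢
  -- uniform exponent
  have hmono : Monotone (fun k => (Q x (N + 1 + k) M).comap
      (LinearMap.toSpanSingleton R M ((∏ i, x i) ^ k • z ^ N • v))) := by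
    refine monotone_nat_of_le_succ fun k r hr => ?_
    have hr' : r • (∏ i, x i) ^ k • z ^ N • v ∈ Q x (N + 1 + k) M := hr
    have h1 := Q_prod 1 hr'
    change r • (∏ i, x i) ^ (k+1) • z ^ N • v ∈ Q x (N + 1 + (k+1)) M
    have h2 : r • (∏ i, x i) ^ (k+1) • z ^ N • v =
        (∏ i, x i) ^ 1 • r • (∏ i, x i) ^ k • z ^ N • v := by module
    rw [h2]
    exact h1
  let I : ℕ →o Ideal R := ⟨_, hmono⟩
  obtain ⟨k, hk⟩ := monotone_stabilizes_iff_noetherian.2 (inferInstance : IsNoetherian R R) I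
  have hk2 : ∀ r ∈ maximalIdeal R, r • (∏ i, x i) ^ k • z ^ N • v ∈ Q x (N + 1 + k) M := by
    intro r hr
    have h0 := hs r hr
    rw [← map_smul, h.zero] at h0
    obtain ⟨l, hl⟩ := h0
    have h1 : r ∈ I l := by
      change r • (∏ i, x i) ^ l • z ^ N • v ∈ Q x (N + 1 + l) M
      convert hl using 1
      module
    have h2 : r ∈ I (max k l) := I.monotone (le_max_right k l) h1
    rw [← hk _ (le_max_left k l)] at h2
    exact h2
  refine ⟨N + k, (∏ i, y i) ^ k • v, ?_, ?_⟩
  · rw [← h.iter (N+1) k, hprod]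
    rw [show N + k + 1 = N + 1 + k by ring]
    congr 1
    module
  · intro r hr
    obtain ⟨p, w, hw, hpw⟩ := mem_Q_last.1 (hk2 r hr)
    refine ⟨p, ?_⟩
    rw [show N + k + 1 = N + 1 + k by ring]
    convert hw using 1
    rw [← hzdef] at hpw
    rw [hprod] at hpw
    linear_combination (norm := module) hpw

/-- Second reduction: using the ideal `b`. -/
lemma step2 [Module.Finite R M] (h : LimPres x L π) (hC : CS x M) {s : L}
    (hs : ∀ r ∈ maximalIdeal R, r • s = 0) :
    ∃ (e : ℕ) (t : M), π (e+1) (x (Fin.last d) ^ e • t) = s ∧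
      ∀ r ∈ maximalIdeal R, ∃ p : M, (r • t - x (Fin.last d) • p) ∈
        Q (fun i : Fin d => x i.castSucc) (e+1) M := by
  obtain ⟨e, u, hu, hp⟩ := step1 h (hs _ (hC.1.1 _)) hs
  refine ⟨e, ?_⟩
  by_cases hb : bIdeal R M (d+1) = ⊤
  · refine ⟨u, hu, fun r hr => ?_⟩
    obtain ⟨p, hp⟩ := hp r hr
    refine ⟨p, ?_⟩
    simpa using b_colon hC.1 (c := 1) (by rw [hb]; trivial) hp
  have hbm : bIdeal R M (d+1) ≤ maximalIdeal R := le_maximalIdeal hb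
  have hp' : ∀ r, ∃ p : M, r ∈ maximalIdeal R → x (Fin.last d) ^ e • (r • u - x (Fin.last d) • p) ∈
        Q (fun i : Fin d => x i.castSucc) (e+1) M := by
    intro r
    by_cases hr : r ∈ maximalIdeal R
    · obtain ⟨p, hp⟩ := hp r hr
      exact ⟨p, fun _ => hp⟩
    · exact ⟨0, fun h => absurd h hr⟩
  choose p hp using hp'
  have key : ∀ c ∈ bIdeal R M (d+1) * bIdeal R M (d+1), ∃ t : M,
      (∀ r ∈ maximalIdeal R, r • t - c • p r ∈ Q (fun i : Fin d => x i.castSucc) (e+1) M) ∧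
      c • u - x (Fin.last d) • t ∈ Q (fun i : Fin d => x i.castSucc) (e+1) M := by
    intro c hc
    refine Submodule.mul_induction_on hc ?_ ?_
    · intro a ha b hb
      have hbm' := hbm hb
      refine ⟨a • p b, fun r hr => ?_, ?_⟩
      · have h1 : x (Fin.last d) ^ (e+1) • (r • p b - b • p r) ∈
            Q (fun i : Fin d => x i.castSucc) (e+1) M := by
          have := Submodule.sub_mem _ (Submodule.smul_mem _ b (hp r hr))
            (Submodule.smul_mem _ r (hp b hbm'))
          convert this using 1
          module
        convert b_colon hC.1 ha h1 using 1
        module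
      · convert b_colon hC.1 ha (hp b hbm') using 1
        module
    · rintro a b ⟨t, ht1, ht2⟩ ⟨t', ht1', ht2'⟩
      refine ⟨t + t', fun r hr => ?_, ?_⟩
      · convert Submodule.add_mem _ (ht1 r hr) (ht1' r hr) using 1
        module
      · convert Submodule.add_mem _ ht2 ht2' using 1
        module
  have hz : x (Fin.last d) ∈ bIdeal R M (d+1) * bIdeal R M (d+1) := by
    rw [← sq]
    exact Ideal.pow_le_pow_right (by omega) hC.last
  obtain ⟨t, ht1, ht2⟩ := key _ hz
  refine ⟨t, ?_, fun r hr => ⟨p r, ht1 r hr⟩⟩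
  rw [← hu, ← sub_eq_zero, ← map_sub]
  refine h.colon (j := 1) ?_
  convert Submodule.smul_mem _ (-(x (Fin.last d) ^ e)) ht2 using 1
  module

end ThmA

section ThmA'
variable {R : Type u} [CommRing R] [IsLocalRing R] [IsNoetherianRing R]

theorem thmA (d : ℕ) : ∀ (M : Type u) [AddCommGroup M] [Module R M] [Module.Finite R M]
    (x : Fin d → R) (L : Type u) [AddCommGroup L] [Module R L] (π : ℕ → M →ₗ[R] L),
    CS x M → LimPres x L π → ∀ s : L, (∀ r ∈ maximalIdeal R, r • s = 0) →
    ∃ t : M, (∀ r ∈ maximalIdeal R, r • t ∈ Q x 1 M) ∧ π 1 t = s := by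
  induction d with
  | zero =>
    intro M _ _ _ x L _ _ π hC h s hs
    obtain ⟨n, u, rfl⟩ := h.surj s
    have hπ : ∀ n, π n u = π 0 u := by
      intro n
      induction n with
      | zero => rfl
      | succ n ih => rw [← ih]; simpa using h.succ n u
    refine ⟨u, fun r hr => ?_, by rw [hπ 1, hπ n]⟩
    have h0 := hs r hr
    rw [hπ n, ← hπ 1, ← map_smul, h.zero] at h0
    obtain ⟨k, hk⟩ := h0
    have := Q_mono (show 1 ≤ 1 + k by omega) hk
    simpa using this
  | succ d ih =>
    intro M _ _ _ x L _ _ π hC h s hs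
    obtain ⟨e, t, rfl, hp⟩ := step2 h hC hs
    set z := x (Fin.last d) with hzdef
    set y : Fin d → R := fun i => x i.castSucc with hy
    have hprod : ∏ i, x i = (∏ i, y i) * z := Fin.prod_univ_castSucc x
    set K : Submodule R M := Ideal.span {z} • ⊤ with hK
    have memK : ∀ {v : M}, v ∈ K ↔ ∃ q, v = z • q := by
      intro v
      rw [hK, Submodule.ideal_span_singleton_smul, Submodule.mem_smul_pointwise_iff_exists]
      exact ⟨fun ⟨q, _, hq⟩ => ⟨q, hq.symm⟩, fun ⟨q, hq⟩ => ⟨q, trivial, hq.symm⟩⟩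
    have hCi : CS y (M ⧸ K) := hC.init (g := K.mkQ) (Submodule.mkQ_surjective K)
      (Submodule.ker_mkQ K)
    obtain ⟨π', h'⟩ := limPres_LC (J := maximalIdeal R) d (M ⧸ K) y (fun i => hC.1.1 _)
      (tc_of_sop hCi.1)
    have hkill : ∀ v w : M, w ∈ Q y (e+1) M → v - w ∈ K → π' (e+1) (K.mkQ v) = 0 := by
      intro v w hw hvw
      have : K.mkQ v = K.mkQ w := (Submodule.Quotient.eq K).2 hvw
      rw [this, h'.zero]
      refine ⟨0, ?_⟩
      simpa using Q_map K.mkQ hw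
    obtain ⟨t', ht1, ht2⟩ := ih (M ⧸ K) y _ π' hCi h' (π' (e+1) (K.mkQ t)) (by
      intro r hr
      obtain ⟨p, hp⟩ := hp r hr
      rw [← map_smul, ← map_smul]
      refine hkill _ _ hp (memK.2 ⟨p, by module⟩))
    obtain ⟨t', rfl⟩ := Submodule.mkQ_surjective K t'
    refine ⟨t', fun r hr => ?_, ?_⟩
    · have h1 := ht1 r hr
      rw [← map_smul] at h1
      obtain ⟨w, hw, hw'⟩ := Q_surj K.mkQ (Submodule.mkQ_surjective K) h1
      obtain ⟨q, hq⟩ := memK.1 ((Submodule.Quotient.eq K).1 hw')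
      refine mem_Q_last.2 ⟨-q, w, hw, ?_⟩
      rw [← hzdef]
      linear_combination (norm := module) -hq
    · rw [← h'.iter 1 e, add_comm 1 e, ← sub_eq_zero, ← map_smul, ← map_sub, ← map_sub,
        h'.zero] at ht2
      obtain ⟨k, hk⟩ := ht2
      rw [← map_smul] at hk
      obtain ⟨w, hw, hw'⟩ := Q_surj K.mkQ (Submodule.mkQ_surjective K) hk
      obtain ⟨q, hq⟩ := memK.1 ((Submodule.Quotient.eq K).1 hw')
      rw [← h.iter 1 e, add_comm 1 e, ← sub_eq_zero, ← map_sub, h.zero]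
      refine ⟨k, ?_⟩
      refine mem_Q_last.2 ⟨-q, z ^ (e + k) • w, Submodule.smul_mem _ _ hw, ?_⟩
      rw [← hzdef, hprod]
      linear_combination (norm := module) - z ^ (e+k) • hq

end ThmA'
end LCAux

namespace LCAux
open Paper

section Fin7
variable {R : Type u} [CommRing R] [IsLocalRing R] [IsNoetherianRing R]

/-- The socle of `N`. -/
abbrev Soc (R : Type u) [CommRing R] [IsLocalRing R] (N : Type u) [AddCommGroup N] [Module R N] :=
  Submodule.torsionBySet R N (maximalIdeal R : Set R)

lemma mem_soc {N : Type u} [AddCommGroup N] [Module R N] {s : N} :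
    s ∈ Soc R N ↔ ∀ r ∈ maximalIdeal R, r • s = 0 := by
  rw [Submodule.mem_torsionBySet_iff]
  exact ⟨fun h r hr => h ⟨r, hr⟩, fun h r => h r.1 r.2⟩

/-- Elements `t` with `m t ⊆ (x) M`. -/
def S1 {d : ℕ} (x : Fin d → R) (M : Type u) [AddCommGroup M] [Module R M] : Submodule R M where
  carrier := {t | ∀ r ∈ maximalIdeal R, r • t ∈ Q x 1 M}
  zero_mem' := fun r _ => by simp
  add_mem' := fun {a b} ha hb r hr => by
    rw [smul_add]; exact Submodule.add_mem _ (ha r hr) (hb r hr)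
  smul_mem' := fun c a ha r hr => by
    rw [smul_comm]; exact Submodule.smul_mem _ _ (ha r hr)

lemma exists_surj {d : ℕ} (M : Type u) [AddCommGroup M] [Module R M] [Module.Finite R M]
    (x : Fin (d+1) → R) (hC : CS x M) (M' : Type u) [AddCommGroup M'] [Module R M']
    (g : M →ₗ[R] M') (hg : Function.Surjective g)
    (hk : LinearMap.ker g = Ideal.span {x 0} • ⊤)
    (L L' : Type u) [AddCommGroup L] [Module R L] [AddCommGroup L'] [Module R L']
    (π : ℕ → M →ₗ[R] L) (π' : ℕ → M' →ₗ[R] L') (h : LimPres x L π)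
    (h' : LimPres (fun i : Fin d => x i.succ) L' π') :
    Module.Finite R (Soc R L') ∧
      ∃ f : Soc R L' →ₗ[R] Soc R L, Function.Surjective f := by
  have : Module.Finite R M' := Module.Finite.of_surjective g hg
  have memK : ∀ {v : M}, g v = 0 ↔ ∃ q, v = x 0 • q := by
    intro v
    rw [← LinearMap.mem_ker, hk, Submodule.ideal_span_singleton_smul,
      Submodule.mem_smul_pointwise_iff_exists]
    exact ⟨fun ⟨q, _, hq⟩ => ⟨q, hq.symm⟩, fun ⟨q, hq⟩ => ⟨q, trivial, hq.symm⟩⟩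
  have hC' := hC.tail hg hk
  have hprod : ∏ i, x i = x 0 * ∏ i : Fin d, x i.succ := Fin.prod_univ_succ x
  have hQ : ∀ v, v ∈ Q x 1 M ↔ g v ∈ Q (fun i : Fin d => x i.succ) 1 M' := by
    intro v
    rw [mem_Q_succ]
    constructor
    · rintro ⟨q, w, hw, rfl⟩
      rw [map_add, memK.2 ⟨q, by rw [pow_one]⟩, zero_add]
      exact Q_map g hw
    · intro hv
      obtain ⟨w, hw, hwv⟩ := Q_surj g hg hv
      obtain ⟨q, hq⟩ := memK.1 (show g (v - w) = 0 by rw [map_sub, hwv, sub_self])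
      exact ⟨q, w, hw, by rw [pow_one, ← hq]; abel⟩
  have hα : ∀ t ∈ S1 x M, (π' 1 ∘ₗ g) t ∈ Soc R L' := by
    intro t ht
    rw [mem_soc]
    intro r hr
    rw [← map_smul, LinearMap.comp_apply, h'.zero]
    exact ⟨0, by simpa using (hQ _).1 (ht r hr)⟩
  have hβ : ∀ t ∈ S1 x M, π 1 t ∈ Soc R L := by
    intro t ht
    rw [mem_soc]
    intro r hr
    rw [← map_smul, h.zero]
    exact ⟨0, by simpa using ht r hr⟩
  let α : S1 x M →ₗ[R] Soc R L' := (π' 1 ∘ₗ g).restrict hα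
  let β : S1 x M →ₗ[R] Soc R L := (π 1).restrict hβ
  have hαs : Function.Surjective α := by
    rintro ⟨s, hs⟩
    obtain ⟨t, ht, rfl⟩ := thmA d M' _ L' π' hC' h' s (mem_soc.1 hs)
    obtain ⟨t, rfl⟩ := hg t
    refine ⟨⟨t, fun r hr => ?_⟩, rfl⟩
    rw [hQ, map_smul]
    exact ht r hr
  have hβs : Function.Surjective β := by
    rintro ⟨s, hs⟩
    obtain ⟨t, ht, rfl⟩ := thmA (d+1) M _ L π hC h s (mem_soc.1 hs)
    exact ⟨⟨t, ht⟩, rfl⟩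
  have hker : LinearMap.ker α ≤ LinearMap.ker β := by
    rintro ⟨t, ht⟩ h0
    have h1 : π' 1 (g t) = 0 := congrArg Subtype.val h0
    refine Subtype.ext ?_
    change π 1 t = 0
    rw [h'.zero] at h1
    obtain ⟨k, hk⟩ := h1
    rw [← map_smul] at hk
    obtain ⟨w, hw, hwv⟩ := Q_surj g hg hk
    obtain ⟨q, hq⟩ := memK.1 (show g ((∏ i : Fin d, x i.succ) ^ k • t - w) = 0 by
      rw [map_sub, hwv, sub_self])
    rw [h.zero]
    refine ⟨k, mem_Q_succ.2 ⟨q, x 0 ^ k • w, Submodule.smul_mem _ _ hw, ?_⟩⟩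
    rw [hprod]
    linear_combination (norm := module) x 0 ^ k • hq
  refine ⟨Module.Finite.of_surjective α hαs, ?_⟩
  refine ⟨(LinearMap.ker α).liftQ β hker ∘ₗ
    (α.quotKerEquivOfSurjective hαs).symm.toLinearMap, ?_⟩
  intro s
  obtain ⟨t, rfl⟩ := hβs s
  refine ⟨α.quotKerEquivOfSurjective hαs ((LinearMap.ker α).mkQ t), ?_⟩
  rw [LinearMap.comp_apply, LinearEquiv.coe_coe, LinearEquiv.symm_apply_apply]
  rfl

end Fin7
end LCAux

open Paper IsLocalRing

/-- For a C-system of parameters `x_1, ..., x_d` of `M`, there is a surjective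
`k`-linear map `Soc(H^{d-1}_m(M/x_1M)) ↠ Soc(H^d_m(M))`; in particular
`dim_k Soc(H^d_m(M)) ≤ dim_k Soc(H^{d-1}_m(M/x_1M))`. -/
theorem stmt6 (R : Type u) [CommRing R] [IsLocalRing R] [IsNoetherianRing R]
    (hCM : IsQuotientOfCMLocalRing R)
    (M : Type u) [AddCommGroup M] [Module R M] [Module.Finite R M]
    (d : ℕ) (hd : 0 < d) (hdim : mdim R M = d)
    (x : Fin d → R) (hx : IsCSOP R M d x) :
    (∃ f : Submodule.torsionBySet R
          ((localCohomology (maximalIdeal R) (d - 1)).obj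
            (ModuleCat.of R (M ⧸ (Ideal.span {x ⟨0, hd⟩} • ⊤ : Submodule R M))))
          (maximalIdeal R : Set R)
        →ₗ[R ⧸ maximalIdeal R]
        Submodule.torsionBySet R
          ((localCohomology (maximalIdeal R) d).obj (ModuleCat.of R M)) (maximalIdeal R : Set R),
      Function.Surjective f) ∧
    socH R M d ≤ socH R (M ⧸ (Ideal.span {x ⟨0, hd⟩} • ⊤ : Submodule R M)) (d - 1) := by
  obtain ⟨d, rfl⟩ : ∃ e, d = e + 1 := ⟨d - 1, by omega⟩
  have hC := LCAux.cs_of_csop hx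
  have hC' := hC.tail (g := (Ideal.span {x 0} • ⊤ : Submodule R M).mkQ)
    (Submodule.mkQ_surjective _) (Submodule.ker_mkQ _)
  obtain ⟨π, h⟩ := LCAux.limPres_LC (J := maximalIdeal R) (d+1) M x hC.1.1
    (LCAux.tc_of_sop hC.1)
  obtain ⟨π', h'⟩ := LCAux.limPres_LC (J := maximalIdeal R) d _ _ hC'.1.1
    (LCAux.tc_of_sop hC'.1)
  obtain ⟨hfin, f, hf⟩ := LCAux.exists_surj M x hC _ _ (Submodule.mkQ_surjective _)
    (Submodule.ker_mkQ _) _ _ π π' h h'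
  have key : ∃ f : Submodule.torsionBySet R
          ((localCohomology (maximalIdeal R) d).obj
            (ModuleCat.of R (M ⧸ (Ideal.span {x 0} • ⊤ : Submodule R M))))
          (maximalIdeal R : Set R)
        →ₗ[R ⧸ maximalIdeal R]
        Submodule.torsionBySet R
          ((localCohomology (maximalIdeal R) (d+1)).obj (ModuleCat.of R M))
          (maximalIdeal R : Set R),
      Function.Surjective f :=
    ⟨LinearMap.extendScalarsOfSurjective Ideal.Quotient.mk_surjective f, hf⟩
  refine ⟨key, ?_⟩
  obtain ⟨F, hF⟩ := key
  have : Module.Finite (R ⧸ maximalIdeal R) (Submodule.torsionBySet R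
          ((localCohomology (maximalIdeal R) d).obj
            (ModuleCat.of R (M ⧸ (Ideal.span {x 0} • ⊤ : Submodule R M))))
          (maximalIdeal R : Set R)) :=
    Module.Finite.of_restrictScalars_finite R _ _
  have h0 := LinearMap.finrank_le_finrank_of_surjective hF
  exact h0
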